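/- arXiv:1706.03109 — 2 statements merged into one kernel-verified Lean document; each statement's English description precedes it below -/
import Mathlib

section
/- If G is a planar graph on n ≥ 4 vertices with girth at least 4, then ψ_s(G) ≤ ⌊√(4n − 31/4) + 1/2⌋. -/
open SimpleGraph

/-- A graph is planar if it has a drawing in the plane: vertices map injectively to points,
edges map to arcs between their endpoints, arc interiors avoid vertex images, and the
interiors of arcs of distinct edges are disjoint. -/
def SimpleGraph.IsPlanar {V : Type*} (G : SimpleGraph V) : Prop :=
  ∃ f : V → ℝ × ℝ, Function.Injective f ∧
    ∃ γ : ∀ ⦃u v : V⦄, G.Adj u v → _root_.Path (f u) (f v),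
      (∀ ⦃u v : V⦄ (h : G.Adj u v), Function.Injective (γ h)) ∧
      (∀ ⦃u v : V⦄ (h : G.Adj u v) (t : unitInterval), t ≠ 0 → t ≠ 1 → ∀ w, γ h t ≠ f w) ∧
      (∀ ⦃u v u' v' : V⦄ (h : G.Adj u v) (h' : G.Adj u' v'), s(u, v) ≠ s(u', v') →
        ∀ s t : unitInterval, s ≠ 0 → s ≠ 1 → γ h s ≠ γ h' t)

/-- The cone over `G`: a new vertex `none` joined to every vertex of `G`. -/
def SimpleGraph.cone {V : Type*} (G : SimpleGraph V) : SimpleGraph (Option V) :=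
  SimpleGraph.fromRel
    (fun x y => (∃ u v, x = some u ∧ y = some v ∧ G.Adj u v) ∨ x = none)

/-- A graph is outerplanar iff the cone over it is planar. -/
def SimpleGraph.IsOuterplanar {V : Type*} (G : SimpleGraph V) : Prop :=
  G.cone.IsPlanar

/-- A complete `k`-coloring: surjective, and every pair of distinct colors appears on an edge. -/
def SimpleGraph.IsCompleteColoring {V : Type*} {k : ℕ} (G : SimpleGraph V)
    (c : V → Fin k) : Prop :=
  Function.Surjective c ∧
    ∀ i j : Fin k, i ≠ j → ∃ u v, G.Adj u v ∧ c u = i ∧ c v = j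

/-- A proper coloring: adjacent vertices receive distinct colors. -/
def SimpleGraph.IsProperColoring {V : Type*} {k : ℕ} (G : SimpleGraph V)
    (c : V → Fin k) : Prop :=
  ∀ ⦃u v : V⦄, G.Adj u v → c u ≠ c v

/-- The pseudoachromatic number: the largest `k` admitting a complete `k`-coloring. -/
noncomputable def SimpleGraph.pseudoachromatic {V : Type*} (G : SimpleGraph V) : ℕ :=
  sSup {k | ∃ c : V → Fin k, G.IsCompleteColoring c}

/-- The achromatic number: the largest `k` admitting a proper complete `k`-coloring. -/
noncomputable def SimpleGraph.achromatic {V : Type*} (G : SimpleGraph V) : ℕ :=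
  sSup {k | ∃ c : V → Fin k, G.IsProperColoring c ∧ G.IsCompleteColoring c}

/-- The chromatic number: the least `k` admitting a proper `k`-coloring. -/
noncomputable def SimpleGraph.chromNum {V : Type*} (G : SimpleGraph V) : ℕ :=
  sInf {k | ∃ c : V → Fin k, G.IsProperColoring c}

/-- The thickness: the least number of planar subgraphs whose union is `G`. -/
noncomputable def SimpleGraph.thickness {V : Type*} (G : SimpleGraph V) : ℕ :=
  sInf {k | ∃ f : Fin k → SimpleGraph V, (∀ i, (f i).IsPlanar) ∧ (⨆ i, f i) = G}

/-- The outerthickness: the least number of outerplanar subgraphs whose union is `G`. -/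
noncomputable def SimpleGraph.outerthickness {V : Type*} (G : SimpleGraph V) : ℕ :=
  sInf {k | ∃ f : Fin k → SimpleGraph V, (∀ i, (f i).IsOuterplanar) ∧ (⨆ i, f i) = G}

/-- The 4-girth-thickness: the least number of planar subgraphs of girth at least 4
whose union is `G`. -/
noncomputable def SimpleGraph.girth4Thickness {V : Type*} (G : SimpleGraph V) : ℕ :=
  sInf {k | ∃ f : Fin k → SimpleGraph V,
    (∀ i, (f i).IsPlanar ∧ 4 ≤ (f i).egirth) ∧ (⨆ i, f i) = G}

namespace SimpleGraph

variable {V : Type*} {G : SimpleGraph V}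

/-- The mod 2 boundary map of a multigraph whose edges are indexed by `E`, with ends `s`, `t`. -/
def endsBoundary {V E : Type*} [DecidableEq V] [Fintype E] (s t : E → V) :
    (E → ZMod 2) →ₗ[ZMod 2] (V → ZMod 2) :=
  ∑ e, (LinearMap.proj e).smulRight (Pi.single (s e) 1 + Pi.single (t e) 1)

lemma endsBoundary_apply {V E : Type*} [DecidableEq V] [Fintype E] (s t : E → V)
    (z : E → ZMod 2) :
    endsBoundary s t z = ∑ e, z e • (Pi.single (s e) 1 + Pi.single (t e) 1 : V → ZMod 2) := by
  ext v
  simp [endsBoundary]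

lemma endsBoundary_apply_apply {V E : Type*} [DecidableEq V] [Fintype E] (s t : E → V)
    (z : E → ZMod 2) (v : V) :
    endsBoundary s t z v =
      ∑ e, z e * ((if s e = v then 1 else 0) + (if t e = v then 1 else 0)) := by
  simp [endsBoundary_apply, Pi.single_apply, mul_add, eq_comm]

/-- In a mod 2 cycle, no vertex is covered by exactly one edge. -/
lemma exists_ne_mem_of_endsBoundary_eq_zero [DecidableEq V] [Fintype G.edgeSet]
    {s t : G.edgeSet → V} (hst : ∀ e, s(s e, t e) = e.1) {z : G.edgeSet → ZMod 2}
    (hz : endsBoundary s t z = 0) {e : G.edgeSet} (he : z e ≠ 0) {v : V} (hv : v ∈ e.1) :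
    ∃ e', e' ≠ e ∧ v ∈ e'.1 ∧ z e' ≠ 0 := by
  by_contra! h
  have h0 := congrFun hz v
  rw [endsBoundary_apply_apply, Finset.sum_eq_single e] at h0
  · have hne : s e ≠ t e := by
      have := e.2
      rw [← hst e] at this
      exact G.ne_of_adj this
    rw [← hst e, Sym2.mem_iff] at hv
    rcases hv with rfl | rfl
    · simp [hne.symm, he] at h0
    · simp [hne, he] at h0
  · intro e' _ hne
    by_cases hv' : v ∈ e'.1
    · simp [h e' hne hv']
    · rw [← hst e', Sym2.mem_iff] at hv'
      push Not at hv'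
      simp [hv'.1.symm, hv'.2.symm]
  · simp

/-- A nonzero mod 2 cycle in a triangle-free graph has at least four edges. -/
lemma four_le_card_of_endsBoundary_eq_zero [DecidableEq V] [Fintype G.edgeSet]
    (htri : ∀ u v w, G.Adj u v → G.Adj v w → ¬ G.Adj w u)
    {s t : G.edgeSet → V} (hst : ∀ e, s(s e, t e) = e.1) {z : G.edgeSet → ZMod 2}
    (hz : endsBoundary s t z = 0) (hne : z ≠ 0) :
    4 ≤ (Finset.univ.filter fun e => z e ≠ 0).card := by
  have next : ∀ u v (h : G.Adj u v), z ⟨s(u, v), h⟩ ≠ 0 →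
      ∃ w, w ≠ u ∧ ∃ h' : G.Adj v w, z ⟨s(v, w), h'⟩ ≠ 0 := by
    intro u v h h0
    obtain ⟨⟨e', he'⟩, h1, h2, h3⟩ := exists_ne_mem_of_endsBoundary_eq_zero hst hz h0
      (v := v) (by simp)
    obtain ⟨w, rfl⟩ := h2
    refine ⟨w, ?_, he', h3⟩
    rintro rfl
    exact h1 (by simp [Sym2.eq_swap])
  obtain ⟨⟨e, he⟩, h0⟩ := Function.ne_iff.1 hne
  induction e using Sym2.ind with | _ u v => ?_
  obtain ⟨w, hwu, hvw, h1⟩ := next u v he h0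
  obtain ⟨x, hxv, hwx, h2⟩ := next v w hvw h1
  have hvu : G.Adj v u := G.adj_symm he
  obtain ⟨y, hyv, huy, h3⟩ := next v u hvu (by simpa [Sym2.eq_swap] using h0)
  have hxu : x ≠ u := by
    rintro rfl
    exact htri _ _ _ he hvw hwx
  have huv : u ≠ v := G.ne_of_adj he
  have hvw' := G.ne_of_adj hvw
  have hwx' := G.ne_of_adj hwx
  have huy' := G.ne_of_adj huy
  have hcard : ({⟨s(u, v), he⟩, ⟨s(v, w), hvw⟩, ⟨s(w, x), hwx⟩, ⟨s(u, y), huy⟩} :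
      Finset G.edgeSet).card = 4 := by
    have h1 : s(u, v) ≠ s(v, w) := by rw [Ne, Sym2.eq_iff]; tauto
    have h2 : s(u, v) ≠ s(w, x) := by rw [Ne, Sym2.eq_iff]; tauto
    have h3 : s(u, v) ≠ s(u, y) := by rw [Ne, Sym2.eq_iff]; tauto
    have h4 : s(v, w) ≠ s(w, x) := by rw [Ne, Sym2.eq_iff]; tauto
    have h5 : s(v, w) ≠ s(u, y) := by rw [Ne, Sym2.eq_iff]; tauto
    have h6 : s(w, x) ≠ s(u, y) := by rw [Ne, Sym2.eq_iff]; tauto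
    rw [Finset.card_insert_of_notMem, Finset.card_insert_of_notMem,
      Finset.card_insert_of_notMem, Finset.card_singleton] <;>
    simp only [Finset.mem_insert, Finset.mem_singleton, Subtype.ext_iff] <;> tauto
  rw [← hcard]
  refine Finset.card_le_card ?_
  intro e
  simp only [Finset.mem_insert, Finset.mem_singleton, Finset.mem_filter, Finset.mem_univ,
    true_and]
  rintro (rfl | rfl | rfl | rfl) <;> assumption

/-- The edge bound for a triangle-free graph having an algebraic dual: each edge `e` separates
the faces `l e` and `r e`, and the mod 2 cycles are exactly the coboundaries of face functions. -/
theorem card_edgeSet_add_four_le_of_dual [Fintype V] [DecidableEq V] [Fintype G.edgeSet]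
    (htri : ∀ u v w, G.Adj u v → G.Adj v w → ¬ G.Adj w u)
    {s t : G.edgeSet → V} (hst : ∀ e, s(s e, t e) = e.1) (hV : 3 ≤ Fintype.card V)
    {F : Type*} (l r : G.edgeSet → F)
    (hlift : ∀ z, endsBoundary s t z = 0 → ∃ y : F → ZMod 2, ∀ e, z e = y (l e) + y (r e))
    (hcycle : ∀ y : F → ZMod 2, endsBoundary s t (fun e => y (l e) + y (r e)) = 0) :
    Fintype.card G.edgeSet + 4 ≤ 2 * Fintype.card V := by
  classical
  have hV0 : Nonempty V := Fintype.card_pos_iff.1 (by omega)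
  have two : ∀ a : ZMod 2, a + a = 0 := CharTwo.add_self_eq_zero
  have hrank : Fintype.card G.edgeSet + 1 ≤
      Module.finrank (ZMod 2) (endsBoundary s t).ker + Fintype.card V := by
    have h1 := (endsBoundary s t).finrank_range_add_finrank_ker
    let σ : (V → ZMod 2) →ₗ[ZMod 2] ZMod 2 := ∑ v, LinearMap.proj v
    have hσ : Function.Surjective σ := fun a =>
      ⟨Pi.single hV0.some a, by simp [σ, Pi.single_apply]⟩
    have h2 := σ.finrank_range_add_finrank_ker
    rw [LinearMap.range_eq_top.2 hσ] at h2
    have h3 : (endsBoundary s t).range ≤ σ.ker := by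
      rintro _ ⟨z, rfl⟩
      rw [LinearMap.mem_ker, endsBoundary_apply, map_sum]
      refine Finset.sum_eq_zero fun e _ => ?_
      simp [σ, Pi.single_apply, Finset.sum_add_distrib, two]
    have h4 := Submodule.finrank_mono h3
    simp only [Module.finrank_fintype_fun_eq_card, finrank_top, Module.finrank_self] at h1 h2
    omega
  let S : Finset F := ((Finset.univ.filter fun e => l e ≠ r e).image l) ∪
    ((Finset.univ.filter fun e => l e ≠ r e).image r)
  let D : (S → ZMod 2) →ₗ[ZMod 2] (G.edgeSet → ZMod 2) := LinearMap.pi fun e =>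
    if h : l e ≠ r e then
      LinearMap.proj ⟨l e, Finset.mem_union_left _
        (Finset.mem_image_of_mem l (by simpa using h))⟩ +
      LinearMap.proj ⟨r e, Finset.mem_union_right _
        (Finset.mem_image_of_mem r (by simpa using h))⟩
    else 0
  have hker : (endsBoundary s t).ker ≤ D.range := by
    intro z hz
    obtain ⟨y, hy⟩ := hlift z hz
    refine ⟨fun f => y f.1, ?_⟩
    ext e
    by_cases h : l e = r e
    · simp [D, h, hy, two]
    · simp [D, h, hy]
  have hD := D.finrank_range_add_finrank_ker
  have hle := Submodule.finrank_mono hker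
  simp only [Module.finrank_fintype_fun_eq_card, Fintype.card_coe] at hD
  have hcount : 4 * S.card ≤ 2 * Fintype.card G.edgeSet := by
    have := Finset.card_mul_le_card_mul (s := S) (t := (Finset.univ : Finset G.edgeSet))
      (fun f e => (if l e = f then (1 : ZMod 2) else 0) + (if r e = f then 1 else 0) ≠ 0)
      (m := 4) (n := 2) ?_ ?_
    · simpa [mul_comm] using this
    · intro f hf
      have := hcycle (fun g => if g = f then 1 else 0)
      refine (four_le_card_of_endsBoundary_eq_zero htri hst this ?_).trans_eq rfl
      simp only [S, Finset.mem_union, Finset.mem_image, Finset.mem_filter, Finset.mem_univ,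
        true_and] at hf
      rcases hf with ⟨e, he, rfl⟩ | ⟨e, he, rfl⟩ <;> refine Function.ne_iff.2 ⟨e, ?_⟩
      · simp [he.symm]
      · simp [he]
    · intro e _
      refine (Finset.card_le_card (t := {l e, r e}) ?_).trans Finset.card_le_two
      intro f hf
      simp only [Finset.bipartiteBelow, Finset.mem_filter] at hf
      by_contra hn
      simp only [Finset.mem_insert, Finset.mem_singleton, not_or] at hn
      exact hf.2 (by simp [Ne.symm hn.1, Ne.symm hn.2])
  rcases S.eq_empty_or_nonempty with hS | ⟨f, hf⟩
  · have hS0 : S.card = 0 := by simp [hS]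
    omega
  · have : Nontrivial D.ker := by
      refine ⟨⟨⟨fun _ => 1, ?_⟩, 0, ?_⟩⟩
      · rw [LinearMap.mem_ker]
        ext e
        by_cases h : l e = r e
        · simp [D, h]
        · simp [D, h, two]
      · intro h
        have := congrFun (congrArg Subtype.val h) ⟨f, hf⟩
        simp at this
    have := Module.finrank_pos (R := ZMod 2) (M := D.ker)
    omega

end SimpleGraph

namespace SquareGrid

/-- The direction vector of the horizontal (`true`) and vertical (`false`) grid edges. -/
def dir (b : Bool) : ℤ × ℤ := if b then (1, 0) else (0, 1)

/-- The far end of a grid edge; the edge `(b, p)` joins `p` to `p + dir b`. -/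
def tgt (q : Bool × ℤ × ℤ) : ℤ × ℤ := q.2 + dir q.1

/-- The second of the two unit squares, indexed by their lower left corners, along a grid edge;
the first one is `q.2`. -/
def face (q : Bool × ℤ × ℤ) : ℤ × ℤ := q.2 - dir (!q.1)

/-- Adjacency in the square grid inside the set `S`. -/
def Step (S : Set (ℤ × ℤ)) (p p' : ℤ × ℤ) : Prop :=
  p ∈ S ∧ p' ∈ S ∧ ∃ q : Bool × ℤ × ℤ, q.2 = p ∧ tgt q = p' ∨ q.2 = p' ∧ tgt q = p

/-- Every two points of `S` are joined by a grid walk in `S`. -/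
def Linked (S : Set (ℤ × ℤ)) : Prop :=
  ∀ p ∈ S, ∀ p' ∈ S, Relation.ReflTransGen (Step S) p p'

lemma Step.symm {S : Set (ℤ × ℤ)} {p p' : ℤ × ℤ} (h : Step S p p') : Step S p' p := by
  obtain ⟨hp, hp', q, hq⟩ := h
  exact ⟨hp', hp, q, hq.symm⟩

lemma Step.mono {S T : Set (ℤ × ℤ)} (h : S ⊆ T) {p p' : ℤ × ℤ} (hp : Step S p p') :
    Step T p p' :=
  ⟨h hp.1, h hp.2.1, hp.2.2⟩

/-- The mod 2 boundary of a chain of grid edges. -/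
def boundary : ((Bool × ℤ × ℤ) → ZMod 2) →ₗ[ZMod 2] (ℤ × ℤ → ZMod 2) where
  toFun c p := ∑ b, (c (b, p) + c (b, p - dir b))
  map_add' c d := by ext p; simp; ring
  map_smul' a c := by ext p; simp; ring

lemma boundary_apply (c : (Bool × ℤ × ℤ) → ZMod 2) (p : ℤ × ℤ) :
    boundary c p = ∑ b, (c (b, p) + c (b, p - dir b)) := rfl

lemma boundary_single (q : Bool × ℤ × ℤ) :
    boundary (Pi.single q 1) = Pi.single q.2 1 + Pi.single (tgt q) 1 := by
  obtain ⟨b, p⟩ := q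
  ext x
  simp only [boundary_apply, Pi.single_apply, Pi.add_apply, Prod.mk.injEq, tgt, sub_eq_iff_eq_add,
    Fintype.sum_bool]
  cases b <;> simp

lemma exists_boundary_eq {S : Set (ℤ × ℤ)} {p p' : ℤ × ℤ}
    (h : Relation.ReflTransGen (Step S) p p') :
    ∃ c, (∀ q, c q ≠ 0 → q.2 ∈ S ∧ tgt q ∈ S) ∧
      boundary c = Pi.single p 1 + Pi.single p' 1 := by
  induction h with
  | refl => exact ⟨0, by simp, by rw [map_zero, CharTwo.add_self_eq_zero]⟩
  | @tail x y _ hxy ih =>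
    obtain ⟨c, hc, hb⟩ := ih
    obtain ⟨hx, hy, q, hq⟩ := hxy
    refine ⟨c + Pi.single q 1, ?_, ?_⟩
    · intro q' hq'
      by_cases h : q' = q
      · subst h
        rcases hq with ⟨rfl, rfl⟩ | ⟨rfl, rfl⟩ <;> exact ⟨‹_›, ‹_›⟩
      · exact hc q' (by simpa [h] using hq')
    · rw [map_add, hb, boundary_single]
      have h2 := CharTwo.add_self_eq_zero (Pi.single x 1 : ℤ × ℤ → ZMod 2)
      rcases hq with ⟨rfl, rfl⟩ | ⟨rfl, rfl⟩ <;> linear_combination h2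

lemma exists_sub_eq {A : Type*} [AddCommGroup A] (g : ℤ → A) :
    ∃ s : ℤ → A, ∀ j, s j - s (j - 1) = g j := by
  refine ⟨fun j => ∑ i ∈ Finset.Ioc 0 j, g i - ∑ i ∈ Finset.Ioc j 0, g i, fun j => ?_⟩
  dsimp only
  rcases lt_or_ge 0 j with h | h
  · have h1 : Finset.Ioc 0 j = insert j (Finset.Ioc 0 (j - 1)) := by
      ext; simp; omega
    have h2 : Finset.Ioc j 0 = ∅ := by ext; simp; omega
    have h3 : Finset.Ioc (j - 1) 0 = ∅ := by ext; simp; omega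
    rw [h1, h2, h3, Finset.sum_insert (by simp)]
    simp
  · have h1 : Finset.Ioc (j - 1) 0 = insert j (Finset.Ioc j 0) := by
      ext; simp; omega
    have h2 : Finset.Ioc 0 j = ∅ := by ext; simp; omega
    have h3 : Finset.Ioc 0 (j - 1) = ∅ := by ext; simp; omega
    rw [h1, h2, h3, Finset.sum_insert (by simp)]
    simp

/-- Every mod 2 cycle of the grid is the coboundary of a function on the unit squares. -/
lemma exists_face_function {c : (Bool × ℤ × ℤ) → ZMod 2} (hc : boundary c = 0) :
    ∃ y : ℤ × ℤ → ZMod 2, ∀ q, c q = y q.2 + y (face q) := by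
  choose s hs using fun i => exists_sub_eq fun j => c (true, i, j)
  have hconst : ∀ i j, s i j - s (i - 1) j - c (false, i, j) =
      s i 0 - s (i - 1) 0 - c (false, i, 0) := by
    intro i
    have step : ∀ j, s i j - s (i - 1) j - c (false, i, j) =
        s i (j - 1) - s (i - 1) (j - 1) - c (false, i, j - 1) := by
      intro j
      have h := congrFun hc (i, j)
      simp [boundary_apply, dir] at h
      rw [← sub_eq_zero]
      have h1 := hs i j
      have h2 := hs (i - 1) j
      have h3 := CharTwo.add_self_eq_zero (c (true, i - 1, j))
      have h4 := CharTwo.add_self_eq_zero (c (false, i, j))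
      linear_combination h1 - h2 + h - h3 - h4
    intro j
    induction j with
    | zero => rfl
    | succ j ih => rw [step, ← ih]; simp
    | pred j ih => rw [← ih, step (-j)]
  obtain ⟨w, hw⟩ := exists_sub_eq fun i => s i 0 - s (i - 1) 0 - c (false, i, 0)
  refine ⟨fun p => s p.1 p.2 - w p.1, ?_⟩
  rintro ⟨b, i, j⟩
  rw [← CharTwo.sub_eq_add]
  cases b
  · simp only [face, dir, Bool.not_false, if_true, Prod.mk_sub_mk, sub_zero]
    linear_combination hw i - hconst i j
  · simp only [face, dir, Bool.not_true, Bool.false_eq_true, if_false, Prod.mk_sub_mk, sub_zero]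
    linear_combination -hs i j

lemma boundary_coboundary (y : ℤ × ℤ → ZMod 2) :
    boundary (fun q => y q.2 + y (face q)) = 0 := by
  ext p
  have h1 := CharTwo.add_self_eq_zero (y p)
  have h2 := CharTwo.add_self_eq_zero (y (p - dir true))
  have h3 := CharTwo.add_self_eq_zero (y (p - dir false))
  have h4 := CharTwo.add_self_eq_zero (y (p - dir true - dir false))
  simp only [boundary_apply, face, Fintype.sum_bool, Bool.not_true, Bool.not_false,
    sub_right_comm p (dir false) (dir true), Pi.zero_apply]
  linear_combination h1 + h2 + h3 + h4

/-- Double counting: the boundary summed over a finite set `B` only sees the edges leaving `B`. -/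
lemma sum_boundary (c : (Bool × ℤ × ℤ) → ZMod 2) (B : Finset (ℤ × ℤ))
    (W : Finset (Bool × ℤ × ℤ))
    (hW : ∀ q, c q * ((if q.2 ∈ B then 1 else 0) + (if tgt q ∈ B then 1 else 0)) ≠ 0 → q ∈ W) :
    ∑ p ∈ B, boundary c p =
      ∑ q ∈ W, c q * ((if q.2 ∈ B then 1 else 0) + (if tgt q ∈ B then 1 else 0)) := by
  classical
  let U : Finset (ℤ × ℤ) := B ∪ B.image (· - dir true) ∪ B.image (· - dir false) ∪ W.image Prod.snd
  have key : ∀ b, ∑ p ∈ B, (c (b, p) + c (b, p - dir b)) = ∑ p ∈ U,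
      c (b, p) * ((if p ∈ B then 1 else 0) + (if tgt (b, p) ∈ B then 1 else 0)) := by
    intro b
    simp only [mul_add, Finset.sum_add_distrib, mul_ite, mul_one, mul_zero, ← Finset.sum_filter]
    congr 1
    · congr 1
      ext p
      simp only [U, Finset.mem_filter, Finset.mem_union]
      tauto
    · have : Finset.filter (fun p => tgt (b, p) ∈ B) U = B.image (· - dir b) := by
        ext p
        simp only [Finset.mem_filter, Finset.mem_image]
        constructor
        · rintro ⟨-, h⟩
          exact ⟨_, h, by simp [tgt]⟩
        · rintro ⟨x, hx, rfl⟩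
          refine ⟨?_, by simpa [tgt] using hx⟩
          simp only [U, Finset.mem_union, Finset.mem_image]
          cases b
          · exact Or.inl (Or.inr ⟨x, hx, rfl⟩)
          · exact Or.inl (Or.inl (Or.inr ⟨x, hx, rfl⟩))
      rw [this, Finset.sum_image (by simp)]
  simp only [boundary_apply]
  rw [Finset.sum_comm, Finset.sum_congr rfl fun b _ => key b, ← Finset.sum_product']
  symm
  refine Finset.sum_subset ?_ ?_
  · intro q hq
    simp only [Finset.mem_product, Finset.mem_univ, true_and, U]
    exact Finset.mem_union_right _ (Finset.mem_image_of_mem _ hq)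
  · intro q _ hq
    by_contra h
    exact hq (hW q h)

lemma reflTransGen_mono {S T : Set (ℤ × ℤ)} (h : S ⊆ T) {p p' : ℤ × ℤ}
    (hp : Relation.ReflTransGen (Step S) p p') : Relation.ReflTransGen (Step T) p p' :=
  Relation.ReflTransGen.mono (fun _ _ => Step.mono h) _ _ hp

lemma reflTransGen_symm {S : Set (ℤ × ℤ)} {p p' : ℤ × ℤ}
    (h : Relation.ReflTransGen (Step S) p p') : Relation.ReflTransGen (Step S) p' p := by
  induction h with
  | refl => exact .refl
  | tail _ h ih => exact ih.head h.symm

variable {V : Type*} {G : SimpleGraph V}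

/-- A triangle-free graph satisfies the planar edge bound if it is a minor of the square grid, with
branch sets `B` and edges realised by the grid edges `q`. -/
theorem card_edgeSet_add_four_le_of_minor [Fintype V] [DecidableEq V] [Fintype G.edgeSet]
    (htri : ∀ u v w, G.Adj u v → G.Adj v w → ¬ G.Adj w u) (hV : 3 ≤ Fintype.card V)
    {s t : G.edgeSet → V} (hst : ∀ e, s(s e, t e) = e.1)
    (B : V → Set (ℤ × ℤ)) (hfin : ∀ v, (B v).Finite) (hne : ∀ v, (B v).Nonempty)
    (hlink : ∀ v, Linked (B v)) (hdisj : ∀ v w, v ≠ w → Disjoint (B v) (B w))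
    (q : G.edgeSet → Bool × ℤ × ℤ)
    (hq : ∀ e, ((q e).2 ∈ B (s e) ∧ tgt (q e) ∈ B (t e)) ∨
      ((q e).2 ∈ B (t e) ∧ tgt (q e) ∈ B (s e))) :
    Fintype.card G.edgeSet + 4 ≤ 2 * Fintype.card V := by
  classical
  have hstne : ∀ e, s e ≠ t e := fun e => by
    have := e.2
    rw [← hst e] at this
    exact G.ne_of_adj this
  have huniq : ∀ {v w p}, p ∈ B v → p ∈ B w → v = w := fun {v w p} hv hw => by
    by_contra h
    exact Set.disjoint_left.1 (hdisj v w h) hv hw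
  have hqinj : Function.Injective q := by
    intro e e' h
    apply Subtype.ext
    rw [← hst, ← hst, Sym2.eq_iff]
    have h1 := hq e
    have h2 := hq e'
    rw [← h] at h2
    rcases h1 with ⟨a, b⟩ | ⟨a, b⟩ <;> rcases h2 with ⟨c, d⟩ | ⟨c, d⟩
    · exact Or.inl ⟨huniq a c, huniq b d⟩
    · exact Or.inr ⟨huniq a c, huniq b d⟩
    · exact Or.inr ⟨huniq b d, huniq a c⟩
    · exact Or.inl ⟨huniq b d, huniq a c⟩
  let T : Set (Bool × ℤ × ℤ) := {x | ∃ v, x.2 ∈ B v ∧ tgt x ∈ B v}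
  have hqT : ∀ e, q e ∉ T := by
    rintro e ⟨v, h1, h2⟩
    rcases hq e with ⟨a, b⟩ | ⟨a, b⟩
    · exact hstne e ((huniq a h1).trans (huniq b h2).symm)
    · exact hstne e ((huniq b h2).trans (huniq a h1).symm)
  let root : V → ℤ × ℤ := fun v => (hne v).some
  have hroot : ∀ v, root v ∈ B v := fun v => (hne v).some_mem
  have hchain : ∀ e, ∃ c : Bool × ℤ × ℤ → ZMod 2,
      (∀ x, x ∉ T → c x = (Pi.single (q e) 1 : Bool × ℤ × ℤ → ZMod 2) x) ∧
      boundary c = Pi.single (root (s e)) 1 + Pi.single (root (t e)) 1 := by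
    intro e
    have aux : ∀ v w, (q e).2 ∈ B v → tgt (q e) ∈ B w → ∃ c : Bool × ℤ × ℤ → ZMod 2,
      (∀ x, x ∉ T → c x = (Pi.single (q e) 1 : Bool × ℤ × ℤ → ZMod 2) x) ∧
      boundary c = Pi.single (root v) 1 + Pi.single (root w) 1 := by
      intro v w hv hw
      obtain ⟨c, hc, hcb⟩ := exists_boundary_eq (hlink v _ hv _ (hroot v))
      obtain ⟨d, hd, hdb⟩ := exists_boundary_eq (hlink w _ hw _ (hroot w))
      refine ⟨Pi.single (q e) 1 + c + d, ?_, ?_⟩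
      · intro x hx
        have h1 : c x = 0 := by
          by_contra h
          exact hx ⟨v, hc x h⟩
        have h2 : d x = 0 := by
          by_contra h
          exact hx ⟨w, hd x h⟩
        simp [h1, h2]
      · rw [map_add, map_add, boundary_single, hcb, hdb]
        have h1 := CharTwo.add_self_eq_zero (Pi.single (q e).2 1 : ℤ × ℤ → ZMod 2)
        have h2 := CharTwo.add_self_eq_zero (Pi.single (tgt (q e)) 1 : ℤ × ℤ → ZMod 2)
        linear_combination h1 + h2
    rcases hq e with ⟨a, b⟩ | ⟨a, b⟩
    · exact aux _ _ a b
    · obtain ⟨c, h1, h2⟩ := aux _ _ a b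
      exact ⟨c, h1, by rw [h2, add_comm]⟩
  choose chain hchain hchainb using hchain
  let Del : Set (Bool × ℤ × ℤ) := {x | x ∉ T ∧ x ∉ Set.range q}
  let r : ℤ × ℤ → ℤ × ℤ → Prop := fun f f' => ∃ x ∈ Del, x.2 = f ∧ face x = f'
  refine card_edgeSet_add_four_le_of_dual htri hst hV (F := Quot r)
    (fun e => Quot.mk r (q e).2) (fun e => Quot.mk r (face (q e))) ?_ ?_
  · intro z hz
    have hval : ∀ x ∉ T, (∑ e, z e • chain e) x =
        ∑ e, z e * (Pi.single (q e) 1 : Bool × ℤ × ℤ → ZMod 2) x := by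
      intro x hx
      simp [hchain _ x hx]
    obtain ⟨y, hy⟩ := exists_face_function (c := ∑ e, z e • chain e) (by
      simp only [map_sum, map_smul, hchainb]
      ext p
      have hsum (w : V → ZMod 2) : ∑ e, z e * (w (s e) + w (t e)) = 0 := by
        have h := congrArg (fun g : V → ZMod 2 => ∑ v, g v * w v) hz
        simp only [endsBoundary_apply_apply, Finset.sum_mul] at h
        rw [Finset.sum_comm] at h
        simpa [add_mul, mul_add, Finset.sum_add_distrib] using h
      simpa [mul_add] using hsum fun v => (Pi.single (root v) 1 : ℤ × ℤ → ZMod 2) p)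
    refine ⟨Quot.lift y ?_, ?_⟩
    · rintro _ _ ⟨x, hx, rfl, rfl⟩
      have h1 := hy x
      rw [hval x hx.1, Finset.sum_eq_zero] at h1
      · exact CharTwo.add_eq_zero.1 h1.symm
      · intro e _
        rw [Pi.single_eq_of_ne, mul_zero]
        rintro rfl
        exact hx.2 ⟨e, rfl⟩
    · intro e
      change z e = y _ + y _
      rw [← hy, hval _ (hqT e)]
      simp [Pi.single_apply, hqinj.eq_iff]
  · intro y
    let c : Bool × ℤ × ℤ → ZMod 2 := fun x => y (Quot.mk r x.2) + y (Quot.mk r (face x))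
    have hc0 : ∀ x, x ∉ T → x ∉ Set.range q → c x = 0 := by
      intro x h1 h2
      have : Quot.mk r x.2 = Quot.mk r (face x) := Quot.sound ⟨x, ⟨h1, h2⟩, rfl, rfl⟩
      simp only [c, this, CharTwo.add_self_eq_zero]
    have hcb : boundary c = 0 := boundary_coboundary fun p => y (Quot.mk r p)
    ext v
    have hsum := sum_boundary c (hfin v).toFinset (Finset.univ.image q) ?_
    · rw [hcb, Finset.sum_image fun _ _ _ _ h => hqinj h] at hsum
      rw [endsBoundary_apply_apply]
      simp only [Pi.zero_apply, Finset.sum_const_zero, Set.Finite.mem_toFinset] at hsum ⊢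
      refine Eq.trans ?_ hsum.symm
      refine Finset.sum_congr rfl fun e _ => ?_
      congr 1
      have hmem : ∀ {w p}, p ∈ B w → (p ∈ B v ↔ w = v) := fun {w p} hp =>
        ⟨fun h => huniq hp h, fun h => h ▸ hp⟩
      rcases hq e with ⟨a, b⟩ | ⟨a, b⟩
      · simp only [hmem a, hmem b]
      · simp only [hmem a, hmem b, add_comm]
    · intro x hx
      by_contra hn
      have hn' : x ∉ Set.range q := by simpa using hn
      by_cases hT : x ∈ T
      · obtain ⟨w, h1, h2⟩ := hT
        by_cases hw : w = v
        · subst hw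
          simp [h1, h2, CharTwo.add_self_eq_zero] at hx
        · have h3 : x.2 ∉ B v := fun h => hw (huniq h1 h)
          have h4 : tgt x ∉ B v := fun h => hw (huniq h2 h)
          simp [h3, h4] at hx
      · simp [hc0 x hT hn'] at hx

/-- The minor criterion with thick edges: `N e` is a linked set meeting the branch sets of the two
ends of `e` and disjoint from everything else. -/
theorem card_edgeSet_add_four_le_of_thick_minor
    [Fintype V] [DecidableEq V] [Fintype G.edgeSet]
    (htri : ∀ u v w, G.Adj u v → G.Adj v w → ¬ G.Adj w u) (hV : 3 ≤ Fintype.card V)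
    {s t : G.edgeSet → V} (hst : ∀ e, s(s e, t e) = e.1)
    (B : V → Set (ℤ × ℤ)) (N : G.edgeSet → Set (ℤ × ℤ))
    (hBfin : ∀ v, (B v).Finite) (hNfin : ∀ e, (N e).Finite) (hne : ∀ v, (B v).Nonempty)
    (hBlink : ∀ v, Linked (B v)) (hNlink : ∀ e, Linked (N e))
    (hBB : ∀ v w, v ≠ w → Disjoint (B v) (B w)) (hNN : ∀ e e', e ≠ e' → Disjoint (N e) (N e'))
    (hBN : ∀ v e, v ≠ s e → v ≠ t e → Disjoint (B v) (N e))
    (hs : ∀ e, (B (s e) ∩ N e).Nonempty) (ht : ∀ e, (B (t e) ∩ N e).Nonempty) :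
    Fintype.card G.edgeSet + 4 ≤ 2 * Fintype.card V := by
  have hstne : ∀ e, s e ≠ t e := fun e => by
    have := e.2
    rw [← hst e] at this
    exact G.ne_of_adj this
  let R : G.edgeSet → Set (ℤ × ℤ) := fun e =>
    {p | ∃ a ∈ B (s e) ∩ N e, Relation.ReflTransGen (Step (N e \ B (t e))) a p}
  have hRN : ∀ e, R e ⊆ N e \ B (t e) := by
    rintro e p ⟨a, ha, hap⟩
    rcases Relation.ReflTransGen.cases_tail hap with rfl | ⟨_, _, h⟩
    · exact ⟨ha.2, Set.disjoint_left.1 (hBB _ _ (hstne e)) ha.1⟩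
    · exact h.2.1
  have hedge : ∀ e, ∃ x : Bool × ℤ × ℤ,
      (x.2 ∈ R e ∧ tgt x ∈ B (t e)) ∨ (x.2 ∈ B (t e) ∧ tgt x ∈ R e) := by
    intro e
    obtain ⟨a, ha⟩ := hs e
    obtain ⟨b, hb⟩ := ht e
    have key : ∀ p, Relation.ReflTransGen (Step (N e)) a p → p ∈ R e ∨ ∃ x : Bool × ℤ × ℤ,
        (x.2 ∈ R e ∧ tgt x ∈ B (t e)) ∨ (x.2 ∈ B (t e) ∧ tgt x ∈ R e) := by
      intro p hp
      induction hp with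
      | refl => exact Or.inl ⟨a, ha, .refl⟩
      | @tail x y _ hxy ih =>
        rcases ih with ih | ih
        · by_cases hy : y ∈ B (t e)
          · obtain ⟨-, -, q, ⟨rfl, rfl⟩ | ⟨rfl, rfl⟩⟩ := hxy
            · exact Or.inr ⟨q, Or.inl ⟨ih, hy⟩⟩
            · exact Or.inr ⟨q, Or.inr ⟨hy, ih⟩⟩
          · obtain ⟨a', ha', hax⟩ := id ih
            exact Or.inl ⟨a', ha', hax.tail ⟨hRN e ih, ⟨hxy.2.1, hy⟩, hxy.2.2⟩⟩
        · exact Or.inr ih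
    exact (key b (hNlink e a ha.2 b hb.2)).resolve_left fun h => (hRN e h).2 hb.1
  choose q hq using hedge
  let B' : V → Set (ℤ × ℤ) := fun v => B v ∪ ⋃ e, ⋃ (_ : s e = v), R e
  have hBB' : ∀ v, B v ⊆ B' v := fun v => Set.subset_union_left
  have hRB' : ∀ e, R e ⊆ B' (s e) := fun e p hp =>
    Or.inr (Set.mem_iUnion₂.2 ⟨e, rfl, hp⟩)
  refine card_edgeSet_add_four_le_of_minor htri hV hst B' ?_ ?_ ?_ ?_ q ?_
  · intro v
    refine (hBfin v).union (Set.finite_iUnion fun e => Set.finite_iUnion fun _ => ?_)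
    exact (hNfin e).subset fun p hp => (hRN e hp).1
  · exact fun v => (hne v).mono (hBB' v)
  · intro v
    have toB : ∀ p ∈ B' v, ∃ a ∈ B v, Relation.ReflTransGen (Step (B' v)) a p := by
      rintro p (hp | hp)
      · exact ⟨p, hp, .refl⟩
      · obtain ⟨e, rfl, a, ha, hap⟩ := Set.mem_iUnion₂.1 hp
        refine ⟨a, ha.1, ?_⟩
        have haR : a ∈ R e := ⟨a, ha, .refl⟩
        clear hp
        induction hap with
        | refl => exact .refl
        | @tail x y hx hxy ih =>
          exact ih.tail ⟨hRB' e ⟨a, ha, hx⟩, hRB' e ⟨a, ha, hx.tail hxy⟩, hxy.2.2⟩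
    intro p hp p' hp'
    obtain ⟨a, ha, hap⟩ := toB p hp
    obtain ⟨a', ha', hap'⟩ := toB p' hp'
    exact ((reflTransGen_symm hap).trans
      (reflTransGen_mono (hBB' v) (hBlink v a ha a' ha'))).trans hap'
  · have hBR : ∀ v e, s e ≠ v → ∀ p ∈ B v, p ∉ R e := by
      intro v e hv p hp hpR
      by_cases h : v = t e
      · exact (hRN e hpR).2 (h ▸ hp)
      · exact Set.disjoint_left.1 (hBN v e hv.symm h) hp (hRN e hpR).1
    intro v w hvw
    rw [Set.disjoint_left]
    rintro p (hp | hp) (hp' | hp')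
    · exact Set.disjoint_left.1 (hBB v w hvw) hp hp'
    · obtain ⟨e, rfl, hpR⟩ := Set.mem_iUnion₂.1 hp'
      exact hBR v e hvw.symm p hp hpR
    · obtain ⟨e, rfl, hpR⟩ := Set.mem_iUnion₂.1 hp
      exact hBR w e hvw p hp' hpR
    · obtain ⟨e, rfl, hpR⟩ := Set.mem_iUnion₂.1 hp
      obtain ⟨e', rfl, hpR'⟩ := Set.mem_iUnion₂.1 hp'
      exact Set.disjoint_left.1 (hNN e e' fun h => hvw (h ▸ rfl)) (hRN e hpR).1 (hRN e' hpR').1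
  · intro e
    rcases hq e with ⟨a, b⟩ | ⟨a, b⟩
    · exact Or.inl ⟨hRB' e a, hBB' _ b⟩
    · exact Or.inr ⟨hBB' _ a, hRB' e b⟩

/-- The plane position of the grid point `p` in the square grid of mesh `δ`. -/
def pt (δ : ℝ) (p : ℤ × ℤ) : ℝ × ℝ := (δ * p.1, δ * p.2)

/-- The grid points of the grid of mesh `δ` at distance less than `δ` from `K`. -/
def disc (δ : ℝ) (K : Set (ℝ × ℝ)) : Set (ℤ × ℤ) := pt δ ⁻¹' Metric.thickening δ K

lemma mem_disc {δ : ℝ} {K : Set (ℝ × ℝ)} {p : ℤ × ℤ} :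
    p ∈ disc δ K ↔ ∃ a ∈ K, dist (pt δ p) a < δ :=
  Metric.mem_thickening_iff

lemma exists_dist_pt_lt {δ : ℝ} (hδ : 0 < δ) (a : ℝ × ℝ) : ∃ p, dist (pt δ p) a < δ := by
  have key : ∀ x : ℝ, |δ * ⌊x / δ⌋ - x| < δ := by
    intro x
    have h1 := mul_le_mul_of_nonneg_left (Int.floor_le (x / δ)) hδ.le
    have h2 := mul_lt_mul_of_pos_left (Int.lt_floor_add_one (x / δ)) hδ
    rw [mul_div_cancel₀ _ hδ.ne'] at h1 h2
    rw [abs_lt]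
    constructor <;> linarith
  exact ⟨(⌊a.1 / δ⌋, ⌊a.2 / δ⌋), max_lt (key _) (key _)⟩

lemma reflTransGen_of_fst {S : Set (ℤ × ℤ)} {i i' j : ℤ} (h : (i, j) ∈ S) (h' : (i', j) ∈ S)
    (hi : |i - i'| ≤ 1) : Relation.ReflTransGen (Step S) (i, j) (i', j) := by
  rw [abs_le] at hi
  obtain rfl | rfl | rfl : i' = i ∨ i' = i + 1 ∨ i = i' + 1 := by omega
  · exact .refl
  · exact .single ⟨h, h', (true, i, j), Or.inl ⟨rfl, by simp [tgt, dir]⟩⟩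
  · exact .single ⟨h, h', (true, i', j), Or.inr ⟨rfl, by simp [tgt, dir]⟩⟩

lemma reflTransGen_of_snd {S : Set (ℤ × ℤ)} {i j j' : ℤ} (h : (i, j) ∈ S) (h' : (i, j') ∈ S)
    (hj : |j - j'| ≤ 1) : Relation.ReflTransGen (Step S) (i, j) (i, j') := by
  rw [abs_le] at hj
  obtain rfl | rfl | rfl : j' = j ∨ j' = j + 1 ∨ j = j' + 1 := by omega
  · exact .refl
  · exact .single ⟨h, h', (false, i, j), Or.inl ⟨rfl, by simp [tgt, dir]⟩⟩
  · exact .single ⟨h, h', (false, i, j'), Or.inr ⟨rfl, by simp [tgt, dir]⟩⟩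

lemma abs_sub_le_one {δ x : ℝ} (hδ : 0 < δ) {i i' : ℤ} (h : |δ * i - x| < δ)
    (h' : |δ * i' - x| < δ) : |i - i'| ≤ 1 := by
  rw [abs_lt] at h h'
  have h1 : (i : ℝ) - i' < 2 := by nlinarith
  have h2 : (i' : ℝ) - i < 2 := by nlinarith
  have h3 : i - i' < 2 := by exact_mod_cast h1
  have h4 : i' - i < 2 := by exact_mod_cast h2
  rw [abs_le]
  omega

lemma linked_disc {δ : ℝ} (hδ : 0 < δ) {K : Set (ℝ × ℝ)} (hK : IsPreconnected K) :
    Linked (disc δ K) := by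
  have cell : ∀ a ∈ K, ∀ p p', dist (pt δ p) a < δ → dist (pt δ p') a < δ →
      Relation.ReflTransGen (Step (disc δ K)) p p' := by
    rintro a ha ⟨i, j⟩ ⟨i', j'⟩ hp hp'
    have hp1 := (max_lt_iff.1 hp).1
    have hp2 := (max_lt_iff.1 hp).2
    have hp1' := (max_lt_iff.1 hp').1
    have hp2' := (max_lt_iff.1 hp').2
    have hm : (i, j') ∈ disc δ K := mem_disc.2 ⟨a, ha, max_lt hp1 hp2'⟩
    exact (reflTransGen_of_snd (mem_disc.2 ⟨a, ha, hp⟩) hm (abs_sub_le_one hδ hp2 hp2')).trans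
      (reflTransGen_of_fst hm (mem_disc.2 ⟨a, ha, hp'⟩) (abs_sub_le_one hδ hp1 hp1'))
  intro p hp p' hp'
  obtain ⟨a, ha, hpa⟩ := mem_disc.1 hp
  obtain ⟨a', ha', hpa'⟩ := mem_disc.1 hp'
  refine hK.induction₂ (fun x y => ∀ p p', dist (pt δ p) x < δ → dist (pt δ p') y < δ →
      Relation.ReflTransGen (Step (disc δ K)) p p') ?_ ?_ ?_ ha ha' p p' hpa hpa'
  · intro x hx
    obtain ⟨p₀, hp₀⟩ := exists_dist_pt_lt hδ x
    have hev : ∀ᶠ y in nhdsWithin x K, dist (pt δ p₀) y < δ :=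
      ((continuous_const.dist continuous_id).continuousAt.eventually_lt_const
        hp₀).filter_mono nhdsWithin_le_nhds
    filter_upwards [hev, self_mem_nhdsWithin] with y hy hyK p p' hp hp'
    exact (cell x hx p p₀ hp hp₀).trans (cell y hyK p₀ p' hy hp')
  · intro x y z _ _ _ hxy hyz p p' hp hp'
    obtain ⟨p₀, hp₀⟩ := exists_dist_pt_lt hδ y
    exact (hxy p p₀ hp hp₀).trans (hyz p₀ p' hp₀ hp')
  · intro x y _ _ hxy p p' hp hp'
    exact reflTransGen_symm (hxy p' p hp' hp)

lemma finite_disc {δ : ℝ} (hδ : 0 < δ) {K : Set (ℝ × ℝ)} (hK : Bornology.IsBounded K) :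
    (disc δ K).Finite := by
  obtain ⟨R, hR⟩ := hK.subset_closedBall 0
  have key : ∀ (i : ℤ) (x : ℝ), |δ * i - x| < δ → |x| ≤ R →
      -⌈(R + δ) / δ⌉ ≤ i ∧ i ≤ ⌈(R + δ) / δ⌉ := by
    intro i x h1 h2
    rw [abs_lt] at h1
    rw [abs_le] at h2
    have h3 := Int.le_ceil ((R + δ) / δ)
    have h4 : (i : ℝ) ≤ (R + δ) / δ := by rw [le_div_iff₀ hδ]; linarith
    have h5 : -(i : ℝ) ≤ (R + δ) / δ := by rw [le_div_iff₀ hδ]; linarith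
    constructor
    · have : -(i : ℝ) ≤ ⌈(R + δ) / δ⌉ := h5.trans h3
      have : -i ≤ ⌈(R + δ) / δ⌉ := by exact_mod_cast this
      omega
    · exact_mod_cast h4.trans h3
  refine (Set.finite_Icc ((-⌈(R + δ) / δ⌉, -⌈(R + δ) / δ⌉) : ℤ × ℤ)
    (⌈(R + δ) / δ⌉, ⌈(R + δ) / δ⌉)).subset ?_
  rintro ⟨i, j⟩ hp
  obtain ⟨a, ha, hpa⟩ := mem_disc.1 hp
  have haR : ‖a‖ ≤ R := by simpa using hR ha
  have h1 := key i a.1 (max_lt_iff.1 hpa).1 ((norm_fst_le a).trans haR)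
  have h2 := key j a.2 (max_lt_iff.1 hpa).2 ((norm_snd_le a).trans haR)
  exact ⟨⟨h1.1, h2.1⟩, ⟨h1.2, h2.2⟩⟩

end SquareGrid

/-- A planar triangle-free graph on `n ≥ 3` vertices has at most `2 (n - 2)` edges. -/
theorem SimpleGraph.IsPlanar.card_edgeSet_add_four_le {V : Type*} {G : SimpleGraph V}
    [Fintype V] [Fintype G.edgeSet] (hG : G.IsPlanar)
    (htri : ∀ u v w, G.Adj u v → G.Adj v w → ¬ G.Adj w u) (hV : 3 ≤ Fintype.card V) :
    Fintype.card G.edgeSet + 4 ≤ 2 * Fintype.card V := by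
  classical
  obtain ⟨f, hf, γ, hinj, hvert, hcross⟩ := hG
  let s : G.edgeSet → V := fun e => (Quot.out e.1).1
  let t : G.edgeSet → V := fun e => (Quot.out e.1).2
  have hst : ∀ e, s(s e, t e) = e.1 := fun e => Quot.out_eq e.1
  have hadj : ∀ e, G.Adj (s e) (t e) := fun e => by
    have := e.2
    rwa [← hst e] at this
  let π : ∀ e, _root_.Path (f (s e)) (f (t e)) := fun e => γ (hadj e)
  have hvert' : ∀ e x, x ≠ 0 → x ≠ 1 → ∀ w, π e x ≠ f w := fun e => hvert (hadj e)
  have hcross' : ∀ e e' x x', x ≠ 0 → x ≠ 1 → π e x = π e' x' → e = e' ∧ x = x' := by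
    intro e e' x x' h0 h1 h
    have hee : e = e' := by
      by_contra hne
      refine hcross (hadj e) (hadj e') ?_ x x' h0 h1 h
      rw [hst, hst]
      exact fun h => hne (Subtype.ext h)
    subst hee
    exact ⟨rfl, hinj _ h⟩
  let a : unitInterval := ⟨1 / 3, by norm_num, by norm_num⟩
  let b : unitInterval := ⟨2 / 3, by norm_num, by norm_num⟩
  have hab : a < b := Subtype.mk_lt_mk.2 (by norm_num)
  have ha0 : 0 < a := Subtype.mk_lt_mk.2 (by norm_num)
  have hb1 : b < 1 := Subtype.mk_lt_mk.2 (by norm_num)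
  let A : V → Set (ℝ × ℝ) := fun v => {f v} ∪
    ((⋃ e, ⋃ (_ : s e = v), π e '' Set.Iic a) ∪ ⋃ e, ⋃ (_ : t e = v), π e '' Set.Ici b)
  let M : G.edgeSet → Set (ℝ × ℝ) := fun e => π e '' Set.Icc a b
  have hAs : ∀ e, π e '' Set.Iic a ⊆ A (s e) := fun e p hp =>
    Or.inr (Or.inl (Set.mem_iUnion₂.2 ⟨e, rfl, hp⟩))
  have hAt : ∀ e, π e '' Set.Ici b ⊆ A (t e) := fun e p hp =>
    Or.inr (Or.inr (Set.mem_iUnion₂.2 ⟨e, rfl, hp⟩))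
  have hA : ∀ v p, p ∈ A v → p = f v ∨ ∃ e x, p = π e x ∧ x ≠ 0 ∧ x ≠ 1 ∧
      ((s e = v ∧ x ≤ a) ∨ (t e = v ∧ b ≤ x)) := by
    rintro v p (hp | hp | hp)
    · exact Or.inl hp
    · obtain ⟨e, rfl, x, hx, rfl⟩ := Set.mem_iUnion₂.1 hp
      by_cases h0 : x = 0
      · exact Or.inl (by rw [h0, (π e).source])
      · exact Or.inr ⟨e, x, rfl, h0, (hx.trans_lt (hab.trans hb1)).ne, Or.inl ⟨rfl, hx⟩⟩
    · obtain ⟨e, rfl, x, hx, rfl⟩ := Set.mem_iUnion₂.1 hp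
      by_cases h1 : x = 1
      · exact Or.inl (by rw [h1, (π e).target])
      · exact Or.inr ⟨e, x, rfl, ((ha0.trans hab).trans_le hx).ne', h1, Or.inr ⟨rfl, hx⟩⟩
  have hAcomp : ∀ v, IsCompact (A v) := by
    intro v
    refine isCompact_singleton.union (.union ?_ ?_) <;>
    refine isCompact_iUnion fun e => isCompact_iUnion fun _ => ?_
    · exact isClosed_Iic.isCompact.image (π e).continuous
    · exact isClosed_Ici.isCompact.image (π e).continuous
  have hMcomp : ∀ e, IsCompact (M e) := fun e => isCompact_Icc.image (π e).continuous
  have hApre : ∀ v, IsPreconnected (A v) := by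
    intro v
    refine isPreconnected_of_forall (f v) ?_
    rintro p (rfl | hp | hp)
    · exact ⟨{f v}, Set.subset_union_left, rfl, rfl, isPreconnected_singleton⟩
    · obtain ⟨e, rfl, hpe⟩ := Set.mem_iUnion₂.1 hp
      exact ⟨_, hAs e, ⟨0, ha0.le, (π e).source⟩, hpe,
        isPreconnected_Iic.image _ (π e).continuous.continuousOn⟩
    · obtain ⟨e, rfl, hpe⟩ := Set.mem_iUnion₂.1 hp
      exact ⟨_, hAt e, ⟨1, hb1.le, (π e).target⟩, hpe,
        isPreconnected_Ici.image _ (π e).continuous.continuousOn⟩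
  have hMpre : ∀ e, IsPreconnected (M e) := fun e =>
    isPreconnected_Icc.image _ (π e).continuous.continuousOn
  have hAA : ∀ v w, v ≠ w → Disjoint (A v) (A w) := by
    intro v w hvw
    rw [Set.disjoint_left]
    intro p hp hp'
    rcases hA v p hp with rfl | ⟨e, x, rfl, h0, h1, hx⟩
    · rcases hA w _ hp' with h | ⟨e, x, h, h0, h1, hx⟩
      · exact hvw (hf h)
      · exact hvert' e x h0 h1 v h.symm
    · rcases hA w _ hp' with h | ⟨e', x', h, h0', h1', hx'⟩
      · exact hvert' e x h0 h1 w h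
      · obtain ⟨rfl, rfl⟩ := hcross' _ _ _ _ h0 h1 h
        rcases hx with ⟨h2, h3⟩ | ⟨h2, h3⟩ <;> rcases hx' with ⟨h4, h5⟩ | ⟨h4, h5⟩
        · exact hvw (h2.symm.trans h4)
        · exact (h5.trans h3).not_gt hab
        · exact (h3.trans h5).not_gt hab
        · exact hvw (h2.symm.trans h4)
  have hMM : ∀ e e', e ≠ e' → Disjoint (M e) (M e') := by
    intro e e' hne
    rw [Set.disjoint_left]
    rintro _ ⟨x, hx, rfl⟩ ⟨x', hx', h⟩
    exact hne (hcross' e e' x x' (ha0.trans_le hx.1).ne' (hx.2.trans_lt hb1).ne h.symm).1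
  have hAM : ∀ v e, v ≠ s e → v ≠ t e → Disjoint (A v) (M e) := by
    intro v e hs ht
    rw [Set.disjoint_left]
    rintro _ hp ⟨x, hx, rfl⟩
    have h0 := (ha0.trans_le hx.1).ne'
    have h1 := (hx.2.trans_lt hb1).ne
    rcases hA v _ hp with h | ⟨e', x', h, -, -, hx'⟩
    · exact hvert' e x h0 h1 v h
    · obtain ⟨rfl, rfl⟩ := hcross' _ _ _ _ h0 h1 h
      rcases hx' with ⟨h2, -⟩ | ⟨h2, -⟩
      · exact hs h2.symm
      · exact ht h2.symm
  have hthick : ∀ K L : Set (ℝ × ℝ), IsCompact K → IsCompact L → Disjoint K L →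
      ∀ᶠ δ in nhdsWithin (0 : ℝ) (Set.Ioi 0),
        Disjoint (SquareGrid.disc δ K) (SquareGrid.disc δ L) := by
    intro K L hK hL hKL
    obtain ⟨ε, hε, hd⟩ := hKL.exists_thickenings hK hL.isClosed
    filter_upwards [Ioo_mem_nhdsGT hε] with δ hδ
    exact (hd.mono (Metric.thickening_mono hδ.2.le _)
      (Metric.thickening_mono hδ.2.le _)).preimage _
  have hev1 : ∀ᶠ δ in nhdsWithin (0 : ℝ) (Set.Ioi 0), ∀ v w, v ≠ w →
      Disjoint (SquareGrid.disc δ (A v)) (SquareGrid.disc δ (A w)) := by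
    simp only [Filter.eventually_all]
    exact fun v w h => hthick _ _ (hAcomp v) (hAcomp w) (hAA v w h)
  have hev2 : ∀ᶠ δ in nhdsWithin (0 : ℝ) (Set.Ioi 0), ∀ e e', e ≠ e' →
      Disjoint (SquareGrid.disc δ (M e)) (SquareGrid.disc δ (M e')) := by
    simp only [Filter.eventually_all]
    exact fun e e' h => hthick _ _ (hMcomp e) (hMcomp e') (hMM e e' h)
  have hev3 : ∀ᶠ δ in nhdsWithin (0 : ℝ) (Set.Ioi 0), ∀ v e, v ≠ s e → v ≠ t e →
      Disjoint (SquareGrid.disc δ (A v)) (SquareGrid.disc δ (M e)) := by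
    simp only [Filter.eventually_all]
    exact fun v e h h' => hthick _ _ (hAcomp v) (hMcomp e) (hAM v e h h')
  obtain ⟨δ, ⟨⟨hBB, hNN⟩, hBN⟩, hδ⟩ :=
    (((hev1.and hev2).and hev3).and self_mem_nhdsWithin).exists
  have hmeet : ∀ K L : Set (ℝ × ℝ), ∀ p ∈ K, p ∈ L →
      (SquareGrid.disc δ K ∩ SquareGrid.disc δ L).Nonempty := by
    intro K L p hK hL
    obtain ⟨x, hx⟩ := SquareGrid.exists_dist_pt_lt hδ p
    exact ⟨x, SquareGrid.mem_disc.2 ⟨p, hK, hx⟩, SquareGrid.mem_disc.2 ⟨p, hL, hx⟩⟩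
  have hfA : ∀ v, f v ∈ A v := fun v => Or.inl rfl
  exact SquareGrid.card_edgeSet_add_four_le_of_thick_minor htri hV hst
    (fun v => SquareGrid.disc δ (A v)) (fun e => SquareGrid.disc δ (M e))
    (fun v => SquareGrid.finite_disc hδ (hAcomp v).isBounded)
    (fun e => SquareGrid.finite_disc hδ (hMcomp e).isBounded)
    (fun v => (hmeet _ _ _ (hfA v) (hfA v)).left)
    (fun v => SquareGrid.linked_disc hδ (hApre v)) (fun e => SquareGrid.linked_disc hδ (hMpre e))
    hBB hNN hBN
    (fun e => hmeet _ _ (π e a) (hAs e ⟨a, Set.self_mem_Iic, rfl⟩) ⟨a, ⟨le_rfl, hab.le⟩, rfl⟩)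
    (fun e => hmeet _ _ (π e b) (hAt e ⟨b, Set.self_mem_Ici, rfl⟩) ⟨b, ⟨hab.le, le_rfl⟩, rfl⟩)

/-- A complete `k`-coloring needs an edge for each of the `k.choose 2` pairs of colors. -/
lemma SimpleGraph.IsCompleteColoring.choose_two_le {V : Type*} {G : SimpleGraph V}
    [Fintype G.edgeSet] {k : ℕ} {c : V → Fin k} (hc : G.IsCompleteColoring c) :
    k.choose 2 ≤ Fintype.card G.edgeSet := by
  classical
  have h := card_edgeFinset_top_eq_card_choose_two (V := Fin k)
  rw [Fintype.card_fin] at h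
  rw [← h, ← Set.toFinset_card]
  refine (Finset.card_le_card (t := G.edgeSet.toFinset.image (Sym2.map c)) ?_).trans
    Finset.card_image_le
  intro e he
  induction e using Sym2.ind with | _ i j => ?_
  obtain ⟨u, v, huv, rfl, rfl⟩ := hc.2 i j (by simpa using he)
  exact Finset.mem_image.2 ⟨s(u, v), by simpa using huv, rfl⟩

lemma SimpleGraph.not_adj_of_four_le_egirth {V : Type*} {G : SimpleGraph V}
    (h : 4 ≤ G.egirth) (u v w : V) (huv : G.Adj u v) (hvw : G.Adj v w) : ¬ G.Adj w u := by
  intro hwu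
  have hcyc : (Walk.cons huv (Walk.cons hvw (Walk.cons hwu Walk.nil))).IsCycle := by
    have h1 := G.ne_of_adj huv
    have h2 := G.ne_of_adj hvw
    have h3 := G.ne_of_adj hwu
    simp [Walk.cons_isCycle_iff, h1, h1.symm, h2, h3, h3.symm]
  have := (le_egirth.1 h) u _ hcyc
  simp only [Walk.length_cons, Walk.length_nil] at this
  norm_cast at this

/-- If `G` is a planar graph on `n ≥ 4` vertices with girth at least 4, then
`ψ_s(G) ≤ ⌊√(4n − 31/4) + 1/2⌋`. -/
theorem pseudoachromatic_le_of_planar_girth_ge_four {V : Type*} [Fintype V]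
    (G : SimpleGraph V) (n : ℕ) (hn : Fintype.card V = n) (h4 : 4 ≤ n)
    (hG : G.IsPlanar) (hgirth : 4 ≤ G.egirth) :
    (G.pseudoachromatic : ℤ) ≤ ⌊Real.sqrt (4 * n - 31 / 4) + 1 / 2⌋ := by
  classical
  subst hn
  have hE := hG.card_edgeSet_add_four_le (not_adj_of_four_le_egirth hgirth) (by omega)
  have key : ∀ k ∈ {k | ∃ c : V → Fin k, G.IsCompleteColoring c},
      (k : ℤ) ≤ ⌊Real.sqrt (4 * Fintype.card V - 31 / 4) + 1 / 2⌋ := by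
    rintro k ⟨c, hc⟩
    have h : ((k.choose 2 + 4 : ℕ) : ℝ) ≤ (2 * Fintype.card V : ℕ) :=
      Nat.cast_le.2 ((Nat.add_le_add_right hc.choose_two_le 4).trans hE)
    push_cast [Nat.cast_choose_two] at h
    rw [Int.le_floor, Int.cast_natCast, ← sub_le_iff_le_add]
    refine Real.le_sqrt_of_sq_le ?_
    linarith
  rcases Set.eq_empty_or_nonempty {k | ∃ c : V → Fin k, G.IsCompleteColoring c} with h | h
  · rw [pseudoachromatic, h, csSup_empty]
    exact Int.floor_nonneg.2 (by positivity)
  · exact key _ (Nat.sSup_mem h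
      ⟨_, fun k hk => Int.ofNat_le.1 ((key k hk).trans (Int.self_le_toNat _))⟩)
end

section
/- For every integer t ≥ 1, the thickness of the complete graph K_{6t} equals t+1. -/
open SimpleGraph

/-- A drawing in which edges without a common endpoint are disjoint; edges may otherwise be
arbitrary path-connecting sets. -/
def SimpleGraph.HasIndependentDrawing {V : Type*} (G : SimpleGraph V) : Prop :=
  ∃ (f : V → ℂ) (S : V → V → Set ℂ),
    (∀ ⦃u v⦄, G.Adj u v → JoinedIn (S u v) (f u) (f v)) ∧
    ∀ ⦃u v x y⦄, G.Adj u v → G.Adj x y → u ≠ x → u ≠ y → v ≠ x → v ≠ y →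
      Disjoint (S u v) (S x y)

/-- `d` is the increment over `[0, 1]` of a continuous logarithm of `p`. -/
def IsLogIncrement (p : ℝ → ℂ) (d : ℂ) : Prop :=
  ∃ L : ℝ → ℂ, Continuous L ∧ (∀ t, Complex.exp (L t) = p t) ∧ L 1 - L 0 = d

theorem exists_continuous_log_prod {F : ℝ × ℝ → ℂ} (hF : Continuous F) (h0 : ∀ x, F x ≠ 0) :
    ∃ L : ℝ × ℝ → ℂ, Continuous L ∧ ∀ x, Complex.exp (L x) = F x := by
  obtain ⟨L, ⟨-, hL⟩, -⟩ := Complex.isCoveringMapOn_exp.existsUnique_continuousMap_lifts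
    ⟨F, hF⟩ (a₀ := 0) (e₀ := Complex.log (F 0)) (Complex.exp_log (h0 0)) (fun x ↦ h0 x)
  exact ⟨L, L.continuous, fun x ↦ congrFun hL x⟩

theorem exists_isLogIncrement {p : ℝ → ℂ} (hp : Continuous p) (h0 : ∀ t, p t ≠ 0) :
    ∃ d, IsLogIncrement p d := by
  obtain ⟨L, hL, hexp⟩ := exists_continuous_log_prod (F := fun x ↦ p x.1) (by fun_prop)
    (fun x ↦ h0 x.1)
  exact ⟨_, fun t ↦ L (t, 0), by fun_prop, fun t ↦ hexp (t, 0), rfl⟩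

theorem IsLogIncrement.unique {p : ℝ → ℂ} {d e : ℂ} (hd : IsLogIncrement p d)
    (he : IsLogIncrement p e) : d = e := by
  obtain ⟨L, hL, hLp, rfl⟩ := hd
  obtain ⟨M, hM, hMp, rfl⟩ := he
  have key : L = fun t ↦ M t + (L 0 - M 0) := by
    refine Complex.isCoveringMap_exp.eq_of_comp_eq hL (by fun_prop) ?_ 0 (by simp)
    funext t
    refine Subtype.ext ?_
    simp only [Function.comp_apply, Complex.exp_add, Complex.exp_sub, hLp, hMp]
    rw [div_self, mul_one]
    rw [← hLp]
    exact Complex.exp_ne_zero _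
  have := congrFun key 1
  linear_combination this

theorem IsLogIncrement.neg {p : ℝ → ℂ} {d : ℂ} (hd : IsLogIncrement p d) :
    IsLogIncrement (fun t ↦ -p t) d := by
  obtain ⟨L, hL, hLp, rfl⟩ := hd
  exact ⟨fun t ↦ L t + Real.pi * Complex.I, by fun_prop,
    fun t ↦ by rw [Complex.exp_add, Complex.exp_pi_mul_I, hLp]; ring, by ring⟩

theorem IsLogIncrement.exists_int {p : ℝ → ℂ} {d a b : ℂ} (hd : IsLogIncrement p d)
    (ha : Complex.exp a = p 0) (hb : Complex.exp b = p 1) :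
    ∃ n : ℤ, d = b - a + n * (2 * Real.pi * Complex.I) := by
  obtain ⟨L, hL, hLp, rfl⟩ := hd
  obtain ⟨m, hm⟩ := Complex.exp_eq_exp_iff_exists_int.1 ((hLp 0).trans ha.symm)
  obtain ⟨n, hn⟩ := Complex.exp_eq_exp_iff_exists_int.1 ((hLp 1).trans hb.symm)
  exact ⟨n - m, by rw [hm, hn]; push_cast; ring⟩

theorem IsLogIncrement.square {P Q : ℝ → ℂ} (hP : Continuous P) (hQ : Continuous Q)
    (hPQ : ∀ s t, P s ≠ Q t) {d₁ d₂ d₃ d₄ : ℂ}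
    (h₁ : IsLogIncrement (fun s ↦ Q 0 - P s) d₁) (h₂ : IsLogIncrement (fun t ↦ P 1 - Q t) d₂)
    (h₃ : IsLogIncrement (fun s ↦ Q 1 - P s) d₃) (h₄ : IsLogIncrement (fun t ↦ P 0 - Q t) d₄) :
    d₁ + d₂ = d₃ + d₄ := by
  obtain ⟨L, hL, hexp⟩ := exists_continuous_log_prod (F := fun x ↦ P x.1 - Q x.2) (by fun_prop)
    (fun x ↦ sub_ne_zero.2 (hPQ _ _))
  rw [h₁.neg.unique ⟨fun s ↦ L (s, 0), by fun_prop, fun s ↦ by simp [hexp], rfl⟩,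
    h₂.unique ⟨fun t ↦ L (1, t), by fun_prop, fun s ↦ by simp [hexp], rfl⟩,
    h₃.neg.unique ⟨fun s ↦ L (s, 1), by fun_prop, fun s ↦ by simp [hexp], rfl⟩,
    h₄.unique ⟨fun t ↦ L (0, t), by fun_prop, fun s ↦ by simp [hexp], rfl⟩]
  ring

theorem JoinedIn.exists_continuous {S : Set ℂ} {x y : ℂ} (h : JoinedIn S x y) :
    ∃ P : ℝ → ℂ, Continuous P ∧ P 0 = x ∧ P 1 = y ∧ ∀ t, P t ∈ S := by
  obtain ⟨γ, hγ⟩ := h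
  exact ⟨γ.extend, γ.continuous_extend, γ.extend_zero, γ.extend_one, fun t ↦ hγ _⟩

theorem not_hasIndependentDrawing_top_fin_five :
    ¬ (⊤ : SimpleGraph (Fin 5)).HasIndependentDrawing := by
  rintro ⟨f, S, hS, hdisj⟩
  have hP : ∀ i j : Fin 5, ∃ P : ℝ → ℂ, i < j →
      Continuous P ∧ P 0 = f i ∧ P 1 = f j ∧ ∀ t, P t ∈ S i j := by
    intro i j
    by_cases h : i < j
    · obtain ⟨P, h'⟩ := (hS ((top_adj i j).2 h.ne)).exists_continuous
      exact ⟨P, fun _ ↦ h'⟩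
    · exact ⟨0, fun h' ↦ absurd h' h⟩
  choose P hP using hP
  have hne : ∀ i j k : Fin 5, j < k → i ≠ j → i ≠ k → ∀ t, f i ≠ P j k t := by
    intro i j k hjk hij hik t heq
    obtain ⟨l, hli, hlj, hlk⟩ : ∃ l, l ≠ i ∧ l ≠ j ∧ l ≠ k := by
      clear * -
      revert i j k
      decide
    refine Set.disjoint_left.1 (hdisj ((top_adj i l).2 hli.symm) ((top_adj j k).2 hjk.ne)
      hij hik hlj hlk) (hS ((top_adj i l).2 hli.symm)).source_mem ?_
    rw [heq]
    exact (hP j k hjk).2.2.2 t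
  have hf : ∀ i j : Fin 5, i < j → f i - f j ≠ 0 := by
    intro i j hij
    obtain ⟨k, hki, hkj⟩ : ∃ k, k ≠ i ∧ k ≠ j := by
      clear * -
      revert i j
      decide
    rw [sub_ne_zero]
    rcases lt_or_gt_of_ne hkj with h | h
    · rw [← (hP k j h).2.2.1]
      exact hne i k j h hki.symm hij.ne 1
    · rw [← (hP j k h).2.1]
      exact hne i j k h hij.ne hki.symm 0
  -- logarithms of the differences, with opposite differences shifted by exactly `π * I`
  obtain ⟨l, hl, hlt⟩ : ∃ l : Fin 5 → Fin 5 → ℂ,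
      (∀ i j, i ≠ j → Complex.exp (l i j) = f i - f j) ∧
      ∀ i j, i < j → l j i = l i j + Real.pi * Complex.I := by
    refine ⟨fun i j ↦ if i < j then Complex.log (f i - f j)
      else Complex.log (f j - f i) + Real.pi * Complex.I, fun i j hij ↦ ?_, fun i j hij ↦ ?_⟩
    · rcases lt_or_gt_of_ne hij with h | h
      · simp only [if_pos h]
        exact Complex.exp_log (hf i j h)
      · simp only [if_neg h.not_gt]
        rw [Complex.exp_add, Complex.exp_pi_mul_I, Complex.exp_log (hf j i h)]
        ring
    · simp only [if_pos hij, if_neg hij.not_gt]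
  have hD : ∀ i j k : Fin 5, ∃ n : ℤ, j < k → i ≠ j → i ≠ k →
      IsLogIncrement (fun t ↦ f i - P j k t)
        (l i k - l i j + n * (2 * Real.pi * Complex.I)) := by
    intro i j k
    by_cases h : j < k ∧ i ≠ j ∧ i ≠ k
    · obtain ⟨hjk, hij, hik⟩ := h
      obtain ⟨hc, hs, ht, -⟩ := hP j k hjk
      obtain ⟨d, hd⟩ := exists_isLogIncrement (p := fun t ↦ f i - P j k t) (by fun_prop)
        (fun t ↦ sub_ne_zero.2 (hne i j k hjk hij hik t))
      obtain ⟨n, rfl⟩ := hd.exists_int (a := l i j) (b := l i k)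
        (by rw [hl i j hij, hs]) (by rw [hl i k hik, ht])
      exact ⟨n, fun _ _ _ ↦ hd⟩
    · exact ⟨0, fun h₁ h₂ h₃ ↦ absurd ⟨h₁, h₂, h₃⟩ h⟩
  choose n hn using hD
  have hsq : ∀ i j k m : Fin 5, i < j → k < m → i ≠ k → i ≠ m → j ≠ k → j ≠ m →
      l k j - l k i + n k i j * (2 * Real.pi * Complex.I)
        + (l j m - l j k + n j k m * (2 * Real.pi * Complex.I))
      = l m j - l m i + n m i j * (2 * Real.pi * Complex.I)
        + (l i m - l i k + n i k m * (2 * Real.pi * Complex.I)) := by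
    intro i j k m hij hkm hik him hjk hjm
    obtain ⟨hc, hs, ht, hm⟩ := hP i j hij
    obtain ⟨hc', hs', ht', hm'⟩ := hP k m hkm
    refine IsLogIncrement.square hc hc' (fun s t h ↦ ?_) ?_ ?_ ?_ ?_
    · exact Set.disjoint_left.1 (hdisj ((top_adj i j).2 hij.ne) ((top_adj k m).2 hkm.ne)
        hik him hjk hjm) (hm s) (h ▸ hm' t)
    · rw [hs']; exact hn k i j hij hik.symm hjk.symm
    · rw [ht]; exact hn j k m hkm hjk hjm
    · rw [ht']; exact hn m i j hij him.symm hjm.symm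
    · rw [hs]; exact hn i k m hkm hik him
  have hcancel : ∀ a : ℤ, (a : ℂ) * (2 * Real.pi * Complex.I) = 0 → a = 0 := by
    intro a ha
    simpa [Real.pi_ne_zero, Complex.I_ne_zero] using ha
  have hsep : ∀ i j k m : Fin 5, i < j → j < k → k < m →
      n k i j + n j k m - n m i j - n i k m = 0 := by
    intro i j k m hij hjk hkm
    apply hcancel
    have := hsq i j k m hij hkm (hij.trans hjk).ne (hij.trans (hjk.trans hkm)).ne hjk.ne
      (hjk.trans hkm).ne
    rw [hlt j k hjk, hlt i k (hij.trans hjk), hlt j m (hjk.trans hkm),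
      hlt i m (hij.trans (hjk.trans hkm))] at this
    push_cast
    linear_combination this
  have hnest : ∀ i j k m : Fin 5, i < k → k < m → m < j →
      n k i j + n j k m - n m i j - n i k m = 0 := by
    intro i j k m hik hkm hmj
    apply hcancel
    have := hsq i j k m (hik.trans (hkm.trans hmj)) hkm hik.ne (hik.trans hkm).ne
      (hkm.trans hmj).ne' hmj.ne'
    rw [hlt k j (hkm.trans hmj), hlt i k hik, hlt m j hmj, hlt i m (hik.trans hkm)] at this
    push_cast
    linear_combination this
  have hcross : ∀ i j k m : Fin 5, i < k → k < j → j < m →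
      n k i j + n j k m - n m i j - n i k m - 1 = 0 := by
    intro i j k m hik hkj hjm
    apply hcancel
    have := hsq i j k m (hik.trans hkj) (hkj.trans hjm) hik.ne (hik.trans (hkj.trans hjm)).ne
      hkj.ne' hjm.ne
    rw [hlt k j hkj, hlt i k hik, hlt j m hjm, hlt i m (hik.trans (hkj.trans hjm))] at this
    push_cast
    linear_combination this
  have hquad : ∀ a b c d : Fin 5, a < b → b < c → c < d →
      (n c a b + n b c d - n d a b - n a c d) + (n b a d + n d b c - n c a d - n a b c)
        + (n b a c + n c b d - n d a c - n a b d) = 1 := by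
    intro a b c d hab hbc hcd
    linarith [hsep a b c d hab hbc hcd, hnest a d b c hab hbc hcd, hcross a c b d hab hbc hcd]
  have h₀ := hquad 0 1 2 3 (by decide) (by decide) (by decide)
  have h₁ := hquad 0 1 2 4 (by decide) (by decide) (by decide)
  have h₂ := hquad 0 1 3 4 (by decide) (by decide) (by decide)
  have h₃ := hquad 0 2 3 4 (by decide) (by decide) (by decide)
  have h₄ := hquad 1 2 3 4 (by decide) (by decide) (by decide)
  omega

namespace SimpleGraph

variable {V : Type*} {G H : SimpleGraph V}

theorem HasIndependentDrawing.mono (hG : G.HasIndependentDrawing) (h : H ≤ G) :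
    H.HasIndependentDrawing := by
  obtain ⟨f, S, hS, hd⟩ := hG
  exact ⟨f, S, fun u v huv ↦ hS (h huv), fun u v x y huv hxy ↦ hd (h huv) (h hxy)⟩

theorem HasIndependentDrawing.cliqueFree_five (hG : G.HasIndependentDrawing) :
    G.CliqueFree 5 := by
  by_contra hc
  obtain ⟨f, S, hS, hd⟩ := hG
  let e := topEmbeddingOfNotCliqueFree hc
  have hadj : ∀ ⦃i j⦄, (⊤ : SimpleGraph (Fin 5)).Adj i j → G.Adj (e i) (e j) :=
    fun i j h ↦ e.map_rel_iff.2 h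
  refine not_hasIndependentDrawing_top_fin_five ⟨fun i ↦ f (e i), fun i j ↦ S (e i) (e j),
    fun i j h ↦ hS (hadj h), fun i j k l h h' h₁ h₂ h₃ h₄ ↦ hd (hadj h) (hadj h')
      (e.injective.ne h₁) (e.injective.ne h₂) (e.injective.ne h₃) (e.injective.ne h₄)⟩

/-- The graph obtained by contracting `y` into `x`; the vertex `y` remains isolated. -/
def contract (G : SimpleGraph V) (x y : V) : SimpleGraph V where
  Adj u v := u ≠ v ∧ u ≠ y ∧ v ≠ y ∧ (G.Adj u v ∨ u = x ∧ G.Adj y v ∨ v = x ∧ G.Adj y u)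
  symm := ⟨by
    rintro u v ⟨h₁, h₂, h₃, h⟩
    refine ⟨h₁.symm, h₃, h₂, ?_⟩
    rw [G.adj_comm v u]
    tauto⟩
  loopless := ⟨fun u h ↦ h.1 rfl⟩

theorem HasIndependentDrawing.contract (hG : G.HasIndependentDrawing) {x y : V}
    (hxy : G.Adj x y) : (G.contract x y).HasIndependentDrawing := by
  classical
  obtain ⟨f, S, hS, hd⟩ := hG
  set T : V → V → Set ℂ := fun u v ↦ if G.Adj u v then S u v else
    if u = x then S x y ∪ S y v else S u y ∪ S y x with hT
  have hcover : ∀ ⦃u v z⦄, (G.contract x y).Adj u v → z ∈ T u v → ∃ p q, G.Adj p q ∧ z ∈ S p q ∧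
      (p = u ∨ p = v ∨ p = y ∧ (u = x ∨ v = x)) ∧
      (q = u ∨ q = v ∨ q = y ∧ (u = x ∨ v = x)) := by
    rintro u v z ⟨-, -, -, huv⟩ hz
    simp only [hT] at hz
    have := G.adj_comm u y
    split_ifs at hz with h₁ h₂
    · exact ⟨u, v, h₁, hz, by simp, by simp⟩
    · rcases hz with hz | hz
      · exact ⟨x, y, hxy, hz, by simp [h₂], by simp [h₂]⟩
      · exact ⟨y, v, by grind, hz, by simp [h₂], by simp⟩
    · have hv : v = x := by tauto
      rcases hz with hz | hz
      · exact ⟨u, y, by tauto, hz, by simp, by simp [hv]⟩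
      · exact ⟨y, x, hxy.symm, hz, by simp [hv], by simp [hv]⟩
  refine ⟨f, T, fun u v huv ↦ ?_, fun u v a b huv hab h₁ h₂ h₃ h₄ ↦ ?_⟩
  · obtain ⟨hne, -, -, h⟩ := huv
    simp only [hT]
    split_ifs with h₁ h₂
    · exact hS h₁
    · subst h₂
      have hyv : G.Adj y v := by
        rcases h with h | h | h
        · exact absurd h h₁
        · exact h.2
        · exact absurd h.1.symm hne
      exact ((hS hxy).mono Set.subset_union_left).trans ((hS hyv).mono Set.subset_union_right)
    · have hyu : v = x ∧ G.Adj y u := by tauto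
      rw [hyu.1]
      exact ((hS hyu.2.symm).mono Set.subset_union_left).trans
        ((hS hxy.symm).mono Set.subset_union_right)
  · rw [Set.disjoint_left]
    intro z hz hz'
    obtain ⟨p, q, hpq, hzS, hp, hq⟩ := hcover huv hz
    obtain ⟨p', q', hpq', hzS', hp', hq'⟩ := hcover hab hz'
    obtain ⟨-, huy, hvy, -⟩ := huv
    obtain ⟨-, hay, hby, -⟩ := hab
    exact Set.disjoint_left.1 (hd hpq hpq' (by grind) (by grind) (by grind) (by grind)) hzS hzS'

theorem IsPlanar.hasIndependentDrawing (hG : G.IsPlanar) : G.HasIndependentDrawing := by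
  obtain ⟨f, hf, γ, -, -, hγ⟩ := hG
  obtain ⟨e, he, hei⟩ : ∃ e : ℝ × ℝ → ℂ, Continuous e ∧ Function.Injective e :=
    ⟨_, Complex.equivRealProdCLM.symm.continuous, Complex.equivRealProdCLM.symm.injective⟩
  refine ⟨fun v ↦ e (f v), fun u v ↦ {z | ∃ (h : G.Adj u v) (t : unitInterval), e (γ h t) = z},
    fun u v h ↦ ⟨(γ h).map he, fun t ↦ ⟨h, t, rfl⟩⟩, ?_⟩
  intro u v x y huv hxy h₁ h₂ h₃ h₄
  rw [Set.disjoint_left]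
  rintro z ⟨_, s, rfl⟩ ⟨_, t, hst⟩
  replace hst := hei hst
  have hne : s(u, v) ≠ s(x, y) := by simp [h₁, h₂]
  by_cases hs : s ≠ 0 ∧ s ≠ 1
  · exact hγ huv hxy hne s t hs.1 hs.2 hst.symm
  by_cases ht : t ≠ 0 ∧ t ≠ 1
  · exact hγ hxy huv hne.symm t s ht.1 ht.2 hst
  have hs' : s = 0 ∨ s = 1 := by tauto
  have ht' : t = 0 ∨ t = 1 := by tauto
  rcases hs' with rfl | rfl <;> rcases ht' with rfl | rfl <;>
    simp only [_root_.Path.source, _root_.Path.target] at hst <;> grind [hf hst]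

section Finite

variable [Fintype V]

open Classical in
theorem card_edgeFinset_le_contract {x y : V} (hxy : G.Adj x y) :
    G.edgeFinset.card ≤ (G.contract x y).edgeFinset.card
      + (G.neighborFinset x ∩ G.neighborFinset y).card + 1 := by
  set R := (G.neighborFinset y \ G.neighborFinset x).erase x with hR
  set E := G.edgeFinset.filter (fun e ↦ y ∉ e) with hE
  have hxny : x ∈ G.neighborFinset y \ G.neighborFinset x := by simp [hxy.symm]
  have hG : G.edgeFinset.card ≤ E.card + (G.neighborFinset y).card := by
    calc G.edgeFinset.card ≤ (E ∪ (G.neighborFinset y).image (fun v ↦ s(y, v))).card := by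
          refine Finset.card_le_card fun e ↦ ?_
          induction e with | _ u v => ?_
          have := G.adj_comm u v
          simp only [hE, mem_edgeFinset, mem_edgeSet, Finset.mem_union, Finset.mem_filter,
            Finset.mem_image, mem_neighborFinset, Sym2.mem_iff, Sym2.eq_iff]
          grind
      _ ≤ _ := (Finset.card_union_le _ _).trans (by gcongr; exact Finset.card_image_le)
  have hC : E.card + R.card ≤ (G.contract x y).edgeFinset.card := by
    calc E.card + R.card = E.card + (R.image (fun v ↦ s(x, v))).card := by
          rw [Finset.card_image_of_injective _ fun a b h ↦ Sym2.congr_right.1 h]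
      _ = (E ∪ R.image (fun v ↦ s(x, v))).card := by
          rw [Finset.card_union_of_disjoint]
          rw [Finset.disjoint_left]
          intro e
          induction e with | _ u v => ?_
          have := G.adj_comm u v
          simp only [hE, hR, mem_edgeFinset, mem_edgeSet, Finset.mem_filter, Finset.mem_sdiff,
            Finset.mem_image, mem_neighborFinset, Sym2.mem_iff, Sym2.eq_iff, Finset.mem_erase]
          grind
      _ ≤ _ := by
          refine Finset.card_le_card fun e ↦ ?_
          induction e with | _ u v => ?_
          have := G.adj_comm u v
          have hne : ∀ a b, G.Adj a b → a ≠ b := fun a b h ↦ h.ne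
          simp only [hE, hR, mem_edgeFinset, mem_edgeSet, Finset.mem_union, Finset.mem_filter,
            Finset.mem_image, mem_neighborFinset, Sym2.mem_iff, Sym2.eq_iff, Finset.mem_erase,
            Finset.mem_sdiff]
          simp only [contract]
          grind
  have h₁ := Finset.card_erase_add_one hxny
  have h₂ := Finset.card_inter_add_card_sdiff (G.neighborFinset y) (G.neighborFinset x)
  rw [Finset.inter_comm] at h₂
  rw [← hR] at h₁
  omega

open Classical in
theorem card_edgeFinset_le_choose_two {s : Finset V} (hs : ∀ ⦃u v⦄, G.Adj u v → u ∈ s) :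
    G.edgeFinset.card ≤ s.card.choose 2 := by
  rw [← Sym2.card_image_offDiag]
  refine Finset.card_le_card fun e ↦ ?_
  induction e with | _ u v => ?_
  intro h
  rw [mem_edgeFinset, mem_edgeSet] at h
  exact Finset.mem_image.2 ⟨(u, v), Finset.mem_offDiag.2 ⟨hs h, hs h.symm, h.ne⟩, rfl⟩

open Classical in
/-- A graph in which every edge at `v` lies in three triangles, where `v` has degree at most
five, has no independent drawing: it contains `K₅`, possibly after contracting an edge. -/
theorem not_hasIndependentDrawing_of_degree_le_five {v w : V} (hvw : G.Adj v w)
    (hdeg : G.degree v ≤ 5)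
    (htri : ∀ u, G.Adj v u → 3 ≤ (G.neighborFinset v ∩ G.neighborFinset u).card) :
    ¬ G.HasIndependentDrawing := by
  intro hG
  set N := G.neighborFinset v with hN
  have hmem : ∀ u, u ∈ N ↔ G.Adj v u := fun u ↦ by simp [hN]
  have hNcard : N.card ≤ 5 := hdeg
  have hclique : ∀ {H : SimpleGraph V}, H.HasIndependentDrawing → ∀ a b c d e : V,
      H.Adj a b → H.Adj a c → H.Adj a d → H.Adj a e → H.Adj b c → H.Adj b d → H.Adj b e →
      H.Adj c d → H.Adj c e → H.Adj d e → False := by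
    intro H hH a b c d e hab hac had hae hbc hbd hbe hcd hce hde
    refine hH.cliqueFree_five {a, b, c, d, e} ⟨?_, ?_⟩
    · simp [Set.pairwise_insert, hab, hac, had, hae, hbc, hbd, hbe, hcd, hce, hde,
        hab.symm, hac.symm, had.symm, hae.symm, hbc.symm, hbd.symm, hbe.symm,
        hcd.symm, hce.symm, hde.symm]
    · simp [hab.ne, hac.ne, had.ne, hae.ne, hbc.ne, hbd.ne, hbe.ne, hcd.ne, hce.ne, hde.ne]
  -- a vertex of `N` has at most one other non-neighbour in `N`, and none if `N` has size four
  have hnon : ∀ a ∈ N, ∀ b ∈ N, a ≠ b → ¬ G.Adj a b →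
      N.card = 5 ∧ ∀ c ∈ N, c ≠ a → c ≠ b → G.Adj a c := by
    intro a ha b hb hab hnab
    have h3 := htri a ((hmem a).1 ha)
    have hsplit := Finset.card_inter_add_card_sdiff N (G.neighborFinset a)
    have hsub : {a, b} ⊆ N \ G.neighborFinset a := by
      simp [Finset.insert_subset_iff, ha, hb, hnab]
    have h2 := Finset.card_le_card hsub
    rw [Finset.card_pair hab] at h2
    refine ⟨by omega, fun c hc hca hcb ↦ ?_⟩
    by_contra hnac
    have hsub' : {a, b, c} ⊆ N \ G.neighborFinset a := by
      simp [Finset.insert_subset_iff, ha, hb, hc, hnab, hnac]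
    have h4 := Finset.card_le_card hsub'
    rw [Finset.card_eq_three.2 ⟨a, b, c, hab, hca.symm, hcb.symm, rfl⟩] at h4
    omega
  by_cases hcl : ∀ a ∈ N, ∀ b ∈ N, a ≠ b → G.Adj a b
  · have h4 : 4 ≤ N.card := by
      have h3 := htri w hvw
      have : (N ∩ G.neighborFinset w).card + 1 ≤ N.card := by
        refine Finset.card_lt_card ⟨Finset.inter_subset_left, fun h ↦ ?_⟩
        simpa using h ((hmem w).2 hvw)
      omega
    obtain ⟨M, hMN, hM⟩ := Finset.exists_subset_card_eq h4
    obtain ⟨a, b, c, d, hab, hac, had, hbc, hbd, hcd, rfl⟩ := Finset.card_eq_four.1 hM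
    simp only [Finset.insert_subset_iff, Finset.singleton_subset_iff] at hMN
    obtain ⟨ha, hb, hc, hd⟩ := hMN
    exact hclique hG v a b c d ((hmem _).1 ha) ((hmem _).1 hb) ((hmem _).1 hc) ((hmem _).1 hd)
      (hcl _ ha _ hb hab) (hcl _ ha _ hc hac) (hcl _ ha _ hd had) (hcl _ hb _ hc hbc)
      (hcl _ hb _ hd hbd) (hcl _ hc _ hd hcd)
  · push Not at hcl
    obtain ⟨a, ha, b, hb, hab, hnab⟩ := hcl
    obtain ⟨h5, hac⟩ := hnon a ha b hb hab hnab
    obtain ⟨-, hbc⟩ := hnon b hb a ha hab.symm fun h ↦ hnab h.symm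
    have hcard : ((N.erase a).erase b).card = 3 := by
      rw [Finset.card_erase_of_mem (Finset.mem_erase.2 ⟨hab.symm, hb⟩),
        Finset.card_erase_of_mem ha, h5]
    obtain ⟨c, d, e, hcd, hce, hde, hrest⟩ := Finset.card_eq_three.1 hcard
    have hin : ∀ z, (z = c ∨ z = d ∨ z = e) → z ∈ N ∧ z ≠ a ∧ z ≠ b := by
      intro z hz
      have : z ∈ (N.erase a).erase b := by rw [hrest]; simpa using hz
      simp only [Finset.mem_erase] at this
      tauto
    -- if `d` and `e` are not adjacent, contracting `b` into `d` makes them so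
    have hcontract : ∀ c d e, (c ∈ N ∧ c ≠ a ∧ c ≠ b) → (d ∈ N ∧ d ≠ a ∧ d ≠ b) →
        (e ∈ N ∧ e ≠ a ∧ e ≠ b) → c ≠ d → c ≠ e → d ≠ e → ¬ G.Adj d e → False := by
      intro c d e hc hd he hcd hce hde hnde
      have hdc := (hnon d hd.1 e he.1 hde hnde).2 c hc.1 hcd hce
      have hec := (hnon e he.1 d hd.1 hde.symm fun h ↦ hnde h.symm).2 c hc.1 hce hcd
      have hva := (hmem a).1 ha
      have hvb := (hmem b).1 hb
      have hvc := (hmem c).1 hc.1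
      have hvd := (hmem d).1 hd.1
      have hve := (hmem e).1 he.1
      have hbd := hbc d hd.1 hd.2.2 hd.2.1
      have hbe := hbc e he.1 he.2.2 he.2.1
      have hkeep : ∀ {p q}, G.Adj p q → p ≠ b → q ≠ b → (G.contract d b).Adj p q :=
        fun h hp hq ↦ ⟨h.ne, hp, hq, Or.inl h⟩
      exact hclique (hG.contract hbd.symm) v a c d e
        (hkeep hva hvb.ne hab) (hkeep hvc hvb.ne hc.2.2) (hkeep hvd hvb.ne hd.2.2)
        (hkeep hve hvb.ne he.2.2) (hkeep (hac c hc.1 hc.2.1 hc.2.2) hab hc.2.2)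
        (hkeep (hac d hd.1 hd.2.1 hd.2.2) hab hd.2.2)
        (hkeep (hac e he.1 he.2.1 he.2.2) hab he.2.2)
        (hkeep hdc.symm hc.2.2 hd.2.2) (hkeep hec.symm hc.2.2 he.2.2)
        ⟨hde, hd.2.2, he.2.2, Or.inr (Or.inl ⟨rfl, hbe⟩)⟩
    have hc := hin c (by simp)
    have hd := hin d (by simp)
    have he := hin e (by simp)
    by_cases h₁ : G.Adj d e
    · by_cases h₂ : G.Adj c e
      · by_cases h₃ : G.Adj c d
        · exact hclique hG v a c d e ((hmem _).1 ha) ((hmem _).1 hc.1) ((hmem _).1 hd.1)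
            ((hmem _).1 he.1) (hac c hc.1 hc.2.1 hc.2.2) (hac d hd.1 hd.2.1 hd.2.2)
            (hac e he.1 he.2.1 he.2.2) h₃ h₂ h₁
        · exact hcontract e c d he hc hd hce.symm hde.symm hcd h₃
      · exact hcontract d c e hd hc he hcd.symm hde hce h₂
    · exact hcontract c d e hc hd he hcd hce hde h₁

open Classical in
theorem HasIndependentDrawing.card_edgeFinset_le_of_support (n : ℕ) :
    ∀ {G : SimpleGraph V}, G.HasIndependentDrawing → ∀ s : Finset V, s.card = n + 4 →
      (∀ ⦃u v⦄, G.Adj u v → u ∈ s) → G.edgeFinset.card ≤ 3 * n + 6 := by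
  induction n with
  | zero =>
    intro G _ s hs hsupp
    simpa [hs, Nat.choose] using card_edgeFinset_le_choose_two hsupp
  | succ n ih =>
    intro G hG s hs hsupp
    by_contra! hlt
    obtain ⟨E, hEG, hE⟩ := Finset.exists_subset_card_eq (s := G.edgeFinset) (n := 3 * n + 10)
      (by omega)
    obtain ⟨H, hHG, hHcard⟩ : ∃ H ≤ G, H.edgeFinset.card = 3 * n + 10 := by
      refine ⟨fromEdgeSet E, fun u v huv ↦ by simpa using hEG ((fromEdgeSet_adj _).1 huv).1, ?_⟩
      rw [← hE]
      congr 1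
      ext e
      simp only [mem_edgeFinset, edgeSet_fromEdgeSet, Set.mem_sdiff, Finset.mem_coe,
        and_iff_left_iff_imp]
      intro he
      exact G.not_isDiag_of_mem_edgeSet (mem_edgeFinset.1 (hEG he))
    have hHd := hG.mono hHG
    have hHs : ∀ ⦃u v⦄, H.Adj u v → u ∈ s := fun u v h ↦ hsupp (hHG h)
    have htri : ∀ u v, H.Adj u v → 3 ≤ (H.neighborFinset u ∩ H.neighborFinset v).card := by
      intro u v huv
      by_contra! h2
      have h := ih (hHd.contract huv) (s.erase v)
        (by rw [Finset.card_erase_of_mem (hHs huv.symm), hs]; omega) (by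
          rintro a b ⟨-, hav, -, h | ⟨rfl, -⟩ | ⟨-, h⟩⟩
          · exact Finset.mem_erase.2 ⟨hav, hHs h⟩
          · exact Finset.mem_erase.2 ⟨hav, hHs huv⟩
          · exact Finset.mem_erase.2 ⟨hav, hHs h.symm⟩)
      have := card_edgeFinset_le_contract huv
      omega
    have hpos : ∀ v ∈ s, ∃ w, H.Adj v w := by
      intro v hv
      by_contra! hnone
      have h := ih hHd (s.erase v) (by rw [Finset.card_erase_of_mem hv, hs]; omega)
        (fun a b hab ↦ Finset.mem_erase.2 ⟨fun h ↦ hnone b (h ▸ hab), hHs hab⟩)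
      omega
    obtain ⟨v, hv, hdeg⟩ : ∃ v ∈ s, H.degree v ≤ 5 := by
      by_contra! h6
      have h := H.sum_degrees_eq_twice_card_edges
      have h' := Finset.sum_le_sum_of_subset (f := fun v ↦ H.degree v) s.subset_univ
      have h'' := Finset.card_nsmul_le_sum s (fun v ↦ H.degree v) 6 h6
      rw [smul_eq_mul] at h''
      omega
    obtain ⟨w, hw⟩ := hpos v hv
    exact not_hasIndependentDrawing_of_degree_le_five hw hdeg (htri v) hHd

open Classical in
theorem IsPlanar.card_edgeFinset_le (hG : G.IsPlanar) (hV : 4 ≤ Fintype.card V) :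
    G.edgeFinset.card + 6 ≤ 3 * Fintype.card V := by
  have := hG.hasIndependentDrawing.card_edgeFinset_le_of_support (Fintype.card V - 4) Finset.univ
    (by rw [Finset.card_univ]; omega) (by simp)
  omega

open Classical in
theorem choose_two_card_le_of_iSup_eq_top {k : ℕ} {f : Fin k → SimpleGraph V}
    (hV : 4 ≤ Fintype.card V) (hf : ∀ i, (f i).IsPlanar) (htop : ⨆ i, f i = ⊤) :
    (Fintype.card V).choose 2 ≤ k * (3 * Fintype.card V - 6) := by
  have hsub : (⊤ : SimpleGraph V).edgeFinset ⊆ Finset.univ.biUnion fun i ↦ (f i).edgeFinset := by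
    intro e
    induction e with | _ u v => ?_
    have h : (⨆ i, f i).Adj u v ↔ (⊤ : SimpleGraph V).Adj u v := by rw [htop]
    simpa using h.2
  calc (Fintype.card V).choose 2 = (⊤ : SimpleGraph V).edgeFinset.card :=
        card_edgeFinset_top_eq_card_choose_two.symm
    _ ≤ ∑ i, (f i).edgeFinset.card := (Finset.card_le_card hsub).trans Finset.card_biUnion_le
    _ ≤ ∑ _i : Fin k, (3 * Fintype.card V - 6) :=
        Finset.sum_le_sum fun i _ ↦ by have := (hf i).card_edgeFinset_le hV; omega
    _ = _ := by simp

end Finite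

/-- No two intervals related by `R` have interleaving endpoints. -/
def NonCrossing (R : ℕ → ℕ → Prop) : Prop :=
  ∀ ⦃a b c d⦄, R a b → R c d → a < c → c < b → ¬ b < d

theorem NonCrossing.eq_of_parabola_eq {R : ℕ → ℕ → Prop} (hR : NonCrossing R) {a b c d : ℕ}
    (hab : R a b) (hcd : R c d) {x : ℝ} (hax : a < x) (hxb : x < b) (hcx : c < x) (hxd : x < d)
    (h : (x - a) * (b - x) = (x - c) * (d - x)) : a = c ∧ b = d := by
  have key : ∀ {a b c d : ℕ}, R a b → R c d → (a < x) → (x < b) → (c < x) → (x < d) →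
      (x - a) * (b - x) = (x - c) * (d - x) → a ≤ c → a = c ∧ b = d := by
    intro a b c d hab hcd hax hxb hcx hxd h hac
    have hcb : c < b := by exact_mod_cast hcx.trans hxb
    rcases hac.eq_or_lt with rfl | hac
    · refine ⟨rfl, ?_⟩
      have := mul_left_cancel₀ (sub_pos.2 hax).ne' h
      exact_mod_cast (sub_left_injective this : (b : ℝ) = d)
    · have hdb : (d : ℝ) ≤ b := by exact_mod_cast not_lt.1 (hR hab hcd hac hcb)
      have hac' : (a : ℝ) < c := by exact_mod_cast hac
      nlinarith
  rcases le_total a c with hac | hac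
  · exact key hab hcd hax hxb hcx hxd h hac
  · exact (key hcd hab hcx hxd hax hxb h.symm hac).imp Eq.symm Eq.symm

/-- The graph on `V` in which `u` and `v` are adjacent when their positions, in increasing order,
are related by `R`. -/
def linkGraph {V : Type*} (pos : V → ℕ) (R : ℕ → ℕ → Prop) : SimpleGraph V where
  Adj u v := pos u < pos v ∧ R (pos u) (pos v) ∨ pos v < pos u ∧ R (pos v) (pos u)
  symm := ⟨fun _ _ h ↦ h.symm⟩
  loopless := ⟨fun u h ↦ by simp at h⟩

/-- A two-page book embedding gives a planar drawing: vertices are placed on a line, and edges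
are drawn as parabolic arcs above or below it. -/
theorem isPlanar_linkGraph {V : Type*} {pos : V → ℕ} (hpos : Function.Injective pos)
    {U D : ℕ → ℕ → Prop} (hU : NonCrossing U) (hD : NonCrossing D) :
    (linkGraph pos fun a b ↦ U a b ∨ D a b).IsPlanar := by
  classical
  set G := linkGraph pos fun a b ↦ U a b ∨ D a b
  let sgn : V → V → ℝ := fun u v ↦
    if U (min (pos u) (pos v)) (max (pos u) (pos v)) then 1 else -1
  let arc : V → V → unitInterval → ℝ × ℝ := fun u v t ↦
    (pos u + (pos v - pos u) * t, sgn u v * ((pos v - pos u) ^ 2 * (t * (1 - t))))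
  let γ : ∀ ⦃u v : V⦄, G.Adj u v → _root_.Path ((pos u : ℝ), (0 : ℝ)) ((pos v : ℝ), (0 : ℝ)) :=
    fun u v _ ↦
      { toFun := arc u v
        continuous_toFun := by fun_prop
        source' := by simp [arc]
        target' := by simp [arc] }
  have hγ : ∀ ⦃u v : V⦄ (h : G.Adj u v) t, γ h t = arc u v t := fun _ _ _ _ ↦ rfl
  have hlt : ∀ ⦃u v : V⦄, G.Adj u v → (pos v : ℝ) - pos u ≠ 0 := by
    intro u v h
    rw [sub_ne_zero, Nat.cast_injective.ne_iff]
    rcases h with h | h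
    · exact h.1.ne'
    · exact h.1.ne
  have hsgn : ∀ u v, sgn u v = 1 ∨ sgn u v = -1 := by
    intro u v
    by_cases h : U (min (pos u) (pos v)) (max (pos u) (pos v)) <;> simp [sgn, h]
  have hint : ∀ t : unitInterval, t ≠ 0 → t ≠ 1 → 0 < (t : ℝ) ∧ (t : ℝ) < 1 := fun t h0 h1 ↦
    ⟨unitInterval.pos_iff_ne_zero.2 h0, unitInterval.lt_one_iff_ne_one.2 h1⟩
  have hheight : ∀ ⦃u v : V⦄, G.Adj u v → ∀ t : unitInterval, t ≠ 0 → t ≠ 1 →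
      0 < (pos v - pos u : ℝ) ^ 2 * (t * (1 - t)) := by
    intro u v h t h0 h1
    obtain ⟨h0, h1⟩ := hint t h0 h1
    have := hlt h
    have : 0 < 1 - (t : ℝ) := by linarith
    positivity
  have harc : ∀ ⦃u v : V⦄, G.Adj u v → ∀ t : unitInterval, t ≠ 0 → t ≠ 1 → (arc u v t).2 ≠ 0 := by
    intro u v h t h0 h1
    exact mul_ne_zero (by rcases hsgn u v with h | h <;> simp [h]) (hheight h t h0 h1).ne'
  -- the page, height and horizontal extent of an interior point, in terms of sorted endpoints
  have hsort : ∀ ⦃u v : V⦄, G.Adj u v → ∀ t : unitInterval, t ≠ 0 → t ≠ 1 →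
      ∃ a b : ℕ, a = min (pos u) (pos v) ∧ b = max (pos u) (pos v) ∧
        (U a b ∨ D a b) ∧
        a < (arc u v t).1 ∧ (arc u v t).1 < b ∧
        (pos v - pos u : ℝ) ^ 2 * (t * (1 - t)) =
          ((arc u v t).1 - a) * (b - (arc u v t).1) := by
    intro u v h t h0 h1
    obtain ⟨h0, h1⟩ := hint t h0 h1
    rcases h with ⟨h, hR⟩ | ⟨h, hR⟩
    · have h' : (pos u : ℝ) < pos v := by exact_mod_cast h
      refine ⟨pos u, pos v, by omega, by omega, hR, ?_, ?_, ?_⟩ <;> simp only [arc]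
      · nlinarith
      · nlinarith
      · ring
    · have h' : (pos v : ℝ) < pos u := by exact_mod_cast h
      refine ⟨pos v, pos u, by omega, by omega, hR, ?_, ?_, ?_⟩ <;> simp only [arc]
      · nlinarith
      · nlinarith
      · ring
  refine ⟨fun v ↦ (pos v, 0), fun u v h ↦ hpos (by simpa using h), γ, ?_, ?_, ?_⟩
  · intro u v h s t hst
    have := congrArg Prod.fst hst
    simp only [hγ, arc, add_right_inj] at this
    exact Subtype.ext (mul_left_cancel₀ (hlt h) this)
  · intro u v h t h0 h1 w hw
    exact harc h t h0 h1 (congrArg Prod.snd hw)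
  · intro u v u' v' h h' hne s t hs0 hs1 hst
    rw [hγ h, hγ h'] at hst
    have hy := harc h s hs0 hs1
    have ht0 : t ≠ 0 := by
      rintro rfl
      exact hy (by rw [hst]; simp [arc])
    have ht1 : t ≠ 1 := by
      rintro rfl
      exact hy (by rw [hst]; simp [arc])
    obtain ⟨a, b, ha, hb, hab, hax, hxb, hp⟩ := hsort h s hs0 hs1
    obtain ⟨c, d, hc, hd, hcd, hcx, hxd, hq⟩ := hsort h' t ht0 ht1
    have hp0 := hheight h s hs0 hs1
    have hq0 := hheight h' t ht0 ht1
    have hsnd : sgn u v * _ = sgn u' v' * _ := congrArg Prod.snd hst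
    have hpage : sgn u v = sgn u' v' := by
      rcases hsgn u v with h₁ | h₁ <;> rcases hsgn u' v' with h₂ | h₂ <;>
        rw [h₁, h₂] at hsnd ⊢ <;> linarith
    rw [hpage] at hsnd
    have heq := mul_left_cancel₀ (by rcases hsgn u' v' with h | h <;> simp [h]) hsnd
    rw [hp, hq, ← hst] at heq
    rw [← hst] at hcx hxd
    have hends : a = c ∧ b = d := by
      simp only [sgn, ← ha, ← hb, ← hc, ← hd] at hpage
      by_cases h₁ : U a b <;> by_cases h₂ : U c d
      · exact hU.eq_of_parabola_eq h₁ h₂ hax hxb hcx hxd heq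
      · norm_num [h₁, h₂] at hpage
      · norm_num [h₁, h₂] at hpage
      · exact hD.eq_of_parabola_eq (hab.resolve_left h₁) (hcd.resolve_left h₂) hax hxb hcx hxd heq
    refine hne (Sym2.eq_iff.2 ?_)
    have : pos u = pos u' ∧ pos v = pos v' ∨ pos u = pos v' ∧ pos v = pos u' := by omega
    exact this.imp (fun h ↦ ⟨hpos h.1, hpos h.2⟩) fun h ↦ ⟨hpos h.1, hpos h.2⟩

theorem IsPlanar.comap {V W : Type*} {G : SimpleGraph W} (hG : G.IsPlanar) {e : V → W}
    (he : Function.Injective e) : (G.comap e).IsPlanar := by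
  obtain ⟨f, hf, γ, h₁, h₂, h₃⟩ := hG
  refine ⟨fun v ↦ f (e v), hf.comp he, fun u v h ↦ γ h, fun u v h ↦ h₁ h,
    fun u v h t h0 h1 w ↦ h₂ h t h0 h1 (e w), fun u v u' v' h h' hne ↦ h₃ h h' fun heq ↦ hne ?_⟩
  simpa [he.eq_iff] using heq

/-- The place of `i` on the zigzag Hamiltonian path `r, r + 1, r - 1, r + 2, …, r + t` modulo
`2 * t`. -/
def zigzag (t r i : ℕ) : ℕ :=
  if i ≤ r then 2 * (r - i) else if i ≤ r + t then 2 * (i - r) - 1 else 2 * (2 * t + r - i)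

/-- Spine order of a planar graph made of three double fans. Each of the three classes has a path
at places `1, …, m` and two poles at places `0` and `m + 1`; the path of a class is joined to
both poles of the next class. -/
def fanPos (m : ℕ) (k : Fin 3) (q : ℕ) : ℕ :=
  match k with
  | 0 => if q ≤ m then q else 2 * m + 4
  | 1 => if q ≤ m then 2 * m + 2 - q else 2 * m + 5
  | 2 => if q = 0 then 2 * m + 3 else if q ≤ m then 3 * m + 6 - q else m + 1

/-- The upper page of the book embedding of three double fans. -/
def fanUpper (m a b : ℕ) : Prop :=
  b = 2 * m + 2 ∧ a ≤ m + 1 ∨ a = m + 1 ∧ b ≤ 2 * m + 2 ∨ a = 2 * m + 4 ∧ b ≤ 3 * m + 5 ∨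
    a = 0 ∧ b = 2 * m + 3 ∨ a = 2 * m + 3 ∧ b = 3 * m + 5

/-- The lower page of the book embedding of three double fans. -/
def fanLower (m a b : ℕ) : Prop :=
  b = 2 * m + 5 ∧ a ≤ m + 1 ∨ b = 2 * m + 3 ∧ m + 1 ≤ a ∨ a = 0 ∧ 2 * m + 5 ≤ b ∨
    a = m + 1 ∧ b = 2 * m + 4 ∨ b = a + 1

theorem nonCrossing_fanUpper (m : ℕ) : NonCrossing (fanUpper m) := by
  unfold NonCrossing fanUpper
  omega

theorem nonCrossing_fanLower (m : ℕ) : NonCrossing (fanLower m) := by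
  unfold NonCrossing fanLower
  omega

/-- Three double fans, whose vertices are pairs of a class and a place in that class. -/
def tripleFan (m : ℕ) : SimpleGraph (Fin 3 × ℕ) :=
  linkGraph (fun v ↦ fanPos m v.1 v.2) fun a b ↦ fanUpper m a b ∨ fanLower m a b

theorem tripleFan_adj_succ {m p : ℕ} (hp : p < m) (k : Fin 3) :
    (tripleFan m).Adj (k, p) (k, p + 1) := by
  simp only [tripleFan, linkGraph]
  fin_cases k <;> simp only [fanPos, fanUpper, fanLower] <;> split_ifs <;>
    first | contradiction | omega

theorem tripleFan_adj_zero {m p : ℕ} (hp : p ≤ m) (k : Fin 3) :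
    (tripleFan m).Adj (k, p) (k + 1, 0) := by
  simp only [tripleFan, linkGraph]
  by_cases h : p = 0 <;> fin_cases k <;> simp [fanPos, fanUpper, fanLower, hp, h] <;> omega

theorem tripleFan_adj_last {m p : ℕ} (hp : p ≤ m + 1) (k : Fin 3) :
    (tripleFan m).Adj (k, p) (k + 1, m + 1) := by
  simp only [tripleFan, linkGraph]
  by_cases h : p = 0 <;> by_cases h' : p ≤ m <;> fin_cases k <;>
    simp [fanPos, fanUpper, fanLower, h, h'] <;> omega

/-- The planar graph of three double fans, with paths and poles read off the `r`-th zigzag. -/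
def fanGraph (t r : ℕ) : SimpleGraph (Fin 3 × Fin (2 * t)) :=
  (tripleFan (2 * t - 2)).comap fun v ↦ (v.1, zigzag t r v.2)

/-- Spine order of the graph of edges missed by all the fan graphs: a Hamiltonian cycle through the
second half of each class, with pendant vertices. -/
def cyclePos (t : ℕ) (k : Fin 3) (i : ℕ) : ℕ :=
  match k with
  | 0 => if i = 0 then 2 * t - 1 else if i < t then 2 * t + 2 * i else 2 * (i - t) - 1
  | 1 => if i = 0 then 6 * t - 1 else if i < t then 2 * i else
      if i = t then 4 * t else 4 * t + 2 * (i - t) - 1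
  | 2 => if i = 0 then 4 * t - 1 else if i < t then 4 * t + 2 * i else
      if i = t then 2 * t else 2 * t + 2 * (i - t) - 1

/-- The graph of edges missed by all the fan graphs. -/
def cycleGraphWithPendants (t : ℕ) : SimpleGraph (Fin 3 × Fin (2 * t)) :=
  linkGraph (fun v ↦ cyclePos t v.1 v.2)
    fun a b ↦ (b = a + 2 ∧ a % 2 = 1) ∨ (b = a + 1 ∨ a = 0)

theorem zigzag_lt {t r i : ℕ} (hr : r < t) (hi : i < 2 * t) : zigzag t r i < 2 * t := by
  unfold zigzag
  split_ifs <;> omega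

theorem zigzag_inj {t r i j : ℕ} (hi : i < 2 * t) (hj : j < 2 * t)
    (h : zigzag t r i = zigzag t r j) : i = j := by
  unfold zigzag at h
  split_ifs at h <;> omega

theorem fanPos_inj {m q q' : ℕ} {k k' : Fin 3} (hq : q ≤ m + 1) (hq' : q' ≤ m + 1)
    (h : fanPos m k q = fanPos m k' q') : k = k' ∧ q = q' := by
  fin_cases k <;> fin_cases k' <;> simp only [fanPos] at h <;> split_ifs at h <;> simp <;> omega

theorem isPlanar_fanGraph {t r : ℕ} (hr : r < t) : (fanGraph t r).IsPlanar := by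
  refine isPlanar_linkGraph (pos := fun v : Fin 3 × Fin (2 * t) ↦ fanPos (2 * t - 2) v.1 (zigzag t r v.2)) ?_
    (nonCrossing_fanUpper _) (nonCrossing_fanLower _)
  rintro ⟨k, i⟩ ⟨k', j⟩ h
  have hi := zigzag_lt hr i.2
  have hj := zigzag_lt hr j.2
  have h' : fanPos (2 * t - 2) k (zigzag t r i) = fanPos (2 * t - 2) k' (zigzag t r j) := h
  obtain ⟨rfl, hq⟩ := fanPos_inj (by omega) (by omega) h'
  exact Prod.ext rfl (Fin.ext (zigzag_inj i.2 j.2 hq))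

theorem cyclePos_inj {t i j : ℕ} {k k' : Fin 3} (hi : i < 2 * t) (hj : j < 2 * t)
    (h : cyclePos t k i = cyclePos t k' j) : k = k' ∧ i = j := by
  fin_cases k <;> fin_cases k' <;> simp only [cyclePos] at h <;> split_ifs at h <;> simp <;> omega

theorem isPlanar_cycleGraphWithPendants (t : ℕ) : (cycleGraphWithPendants t).IsPlanar := by
  refine isPlanar_linkGraph ?_ (by unfold NonCrossing; omega) (by unfold NonCrossing; omega)
  rintro ⟨k, i⟩ ⟨k', j⟩ h
  obtain ⟨rfl, hij⟩ := cyclePos_inj i.2 j.2 h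
  exact Prod.ext rfl (Fin.ext hij)

theorem exists_zigzag_consecutive {t i j : ℕ} (hij : i < j) (hj : j < 2 * t) :
    (∃ r < t, zigzag t r i < 2 * t - 1 ∧ zigzag t r j < 2 * t - 1 ∧
      (zigzag t r i = zigzag t r j + 1 ∨ zigzag t r j = zigzag t r i + 1)) ∨
    j = i + 1 ∧ t ≤ i ∨ i = 0 ∧ j = 2 * t - 1 := by
  by_cases h : j = i + 1 ∧ t ≤ i ∨ i = 0 ∧ j = 2 * t - 1
  · exact Or.inr h
  left
  obtain ⟨c, hc⟩ : ∃ c, i + j = 2 * c ∨ i + j = 2 * c + 1 := ⟨(i + j) / 2, by omega⟩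
  rcases lt_or_ge c t with hct | hct
  · refine ⟨c, hct, ?_⟩
    have h₁ : zigzag t c i = 2 * (c - i) := if_pos (by omega)
    have h₂ : zigzag t c j = 2 * (j - c) - 1 := by
      unfold zigzag
      split_ifs <;> omega
    omega
  · refine ⟨c - t, by omega, ?_⟩
    have h₁ : zigzag t (c - t) i = 2 * (i + t - c) - 1 := by
      unfold zigzag
      split_ifs <;> omega
    have h₂ : zigzag t (c - t) j = 2 * (t + c - j) := by
      unfold zigzag
      split_ifs <;> omega
    omega

theorem adj_of_same_class {t : ℕ} (k : Fin 3) {i j : Fin (2 * t)} (hij : i < j) :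
    (∃ r < t, (fanGraph t r).Adj (k, i) (k, j)) ∨
      (cycleGraphWithPendants t).Adj (k, i) (k, j) := by
  rcases exists_zigzag_consecutive hij j.2 with ⟨r, hr, hi, hj, h⟩ | h
  · refine Or.inl ⟨r, hr, ?_⟩
    simp only [fanGraph, comap_adj]
    rcases h with h | h <;> rw [h]
    · exact (tripleFan_adj_succ (by omega) k).symm
    · exact tripleFan_adj_succ (by omega) k
  · right
    simp only [cycleGraphWithPendants, linkGraph]
    have := j.2
    fin_cases k <;> simp only [cyclePos] <;> split_ifs <;> omega

theorem adj_of_next_class {t : ℕ} (k : Fin 3) (i j : Fin (2 * t)) :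
    (∃ r < t, (fanGraph t r).Adj (k, i) (k + 1, j)) ∨
      (cycleGraphWithPendants t).Adj (k, i) (k + 1, j) := by
  have hi := i.2
  have hj := j.2
  by_cases h : i = j + t
  · right
    simp only [cycleGraphWithPendants, linkGraph]
    fin_cases k <;> simp [cyclePos] <;> split_ifs <;> omega
  · obtain ⟨r, hr, hpole⟩ : ∃ r < t,
        zigzag t r j = 0 ∧ zigzag t r i ≠ 2 * t - 1 ∨ zigzag t r j = 2 * t - 1 := by
      refine ⟨if (j : ℕ) < t then j else j - t, ?_⟩
      unfold zigzag
      split_ifs <;> omega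
    have hp := zigzag_lt hr hi
    refine Or.inl ⟨r, hr, ?_⟩
    simp only [fanGraph, comap_adj]
    rcases hpole with ⟨hq, hne⟩ | hq <;> rw [hq]
    · exact tripleFan_adj_zero (by omega) k
    · have := tripleFan_adj_last (m := 2 * t - 2) (p := zigzag t r i) (by omega) k
      rwa [show 2 * t - 2 + 1 = 2 * t - 1 by omega] at this

theorem exists_isPlanar_iSup_eq_top (t : ℕ) :
    ∃ f : Fin (t + 1) → SimpleGraph (Fin 3 × Fin (2 * t)), (∀ r, (f r).IsPlanar) ∧
      ⨆ r, f r = ⊤ := by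
  refine ⟨fun r ↦ if (r : ℕ) < t then fanGraph t r else cycleGraphWithPendants t, fun r ↦ ?_, ?_⟩
  · dsimp only
    split_ifs with hr
    · exact isPlanar_fanGraph hr
    · exact isPlanar_cycleGraphWithPendants t
  · set f : Fin (t + 1) → SimpleGraph (Fin 3 × Fin (2 * t)) :=
      fun r ↦ if (r : ℕ) < t then fanGraph t r else cycleGraphWithPendants t
    have key : ∀ u v, ((∃ r < t, (fanGraph t r).Adj u v) ∨ (cycleGraphWithPendants t).Adj u v) →
        (⨆ r, f r).Adj u v := by
      rintro u v (⟨r, hr, h⟩ | h)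
      · exact iSup_adj.2 ⟨⟨r, by omega⟩, by simpa [f, hr] using h⟩
      · exact iSup_adj.2 ⟨Fin.last t, by simpa [f] using h⟩
    refine eq_top_iff.2 ?_
    rintro ⟨k, i⟩ ⟨l, j⟩ (hne : (k, i) ≠ (l, j))
    have hkl : ∀ k l : Fin 3, k = l ∨ l = k + 1 ∨ k = l + 1 := by decide
    rcases hkl k l with rfl | rfl | rfl
    · rcases lt_or_gt_of_ne (show i ≠ j by rintro rfl; exact hne rfl) with hij | hij
      · exact key _ _ (adj_of_same_class k hij)
      · exact (key _ _ (adj_of_same_class k hij)).symm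
    · exact key _ _ (adj_of_next_class k i j)
    · exact (key _ _ (adj_of_next_class l j i)).symm

end SimpleGraph

/-- For every `t ≥ 1`, the thickness of `K_{6t}` equals `t + 1`. -/
theorem thickness_completeGraph_six_mul (t : ℕ) (ht : 1 ≤ t) :
    (⊤ : SimpleGraph (Fin (6 * t))).thickness = t + 1 := by
  have hmem : t + 1 ∈ {k | ∃ f : Fin k → SimpleGraph (Fin (6 * t)),
      (∀ i, (f i).IsPlanar) ∧ (⨆ i, f i) = ⊤} := by
    obtain ⟨f, hf, htop⟩ := exists_isPlanar_iSup_eq_top t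
    let e : Fin (6 * t) ≃ Fin 3 × Fin (2 * t) := (finCongr (by ring)).trans finProdFinEquiv.symm
    refine ⟨fun r ↦ (f r).comap e, fun r ↦ (hf r).comap e.injective, eq_top_iff.2 fun u v huv ↦ ?_⟩
    have h : (⨆ r, f r).Adj (e u) (e v) := htop ▸ e.injective.ne huv
    obtain ⟨r, hr⟩ := iSup_adj.1 h
    exact iSup_adj.2 ⟨r, hr⟩
  refine le_antisymm (Nat.sInf_le hmem) (le_csInf ⟨_, hmem⟩ ?_)
  rintro k ⟨f, hf, htop⟩
  by_contra! hk
  have hbound := choose_two_card_le_of_iSup_eq_top (by simp; omega) hf htop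
  have hchoose : (6 * t).choose 2 = 3 * t * (6 * t - 1) := by
    rw [Nat.choose_two_right, show 6 * t * (6 * t - 1) = 2 * (3 * t * (6 * t - 1)) by ring]
    simp
  have hle : k * (3 * (6 * t) - 6) ≤ t * (3 * (6 * t) - 6) := Nat.mul_le_mul_right _ (by omega)
  rw [Fintype.card_fin, hchoose] at hbound
  obtain ⟨s, rfl⟩ := Nat.exists_eq_add_of_le' ht
  have h₁ : 6 * (s + 1) - 1 = 6 * s + 5 := by omega
  have h₂ : 3 * (6 * (s + 1)) - 6 = 18 * s + 12 := by omega
  rw [h₁] at hbound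
  rw [h₂] at hbound hle
  nlinarith
end
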